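/- arXiv:2402.03850 — 3 statements merged into one kernel-verified Lean document; each statement's English description precedes it below -/
import Mathlib

section
/- Let q = 2^n with n > 3, let d = 2^{n−2}, let α_n = ω + 2 and γ_n = ω + ω_{d−1} + 3 in O_{2^n}, where ω = ζ_{2^n} + ζ_{2^n}^{-1} and ω_j = ζ_{2^n}^j + ζ_{2^n}^{-j}. Then the product α_n·γ_n is an indecomposable totally positive integer in O_{2^n}. -/
open NumberField

/-- The maximal totally real subfield `K_q = ℚ(ζ_q + ζ_q⁻¹)` of the `q`-th cyclotomic field,
realized inside `ℝ` as `ℚ(2 cos(2π/q))`. -/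
noncomputable def Kq (q : ℕ) : IntermediateField ℚ ℝ :=
  IntermediateField.adjoin ℚ {2 * Real.cos (2 * Real.pi / q)}

/-- `ω_j = ζ_q^j + ζ_q^{-j} = 2 cos(2πj/q)` as a real number. -/
noncomputable def omegaJReal (q : ℕ) (j : ℕ) : ℝ := 2 * Real.cos (2 * Real.pi * j / q)

/-- An element `α` of the ring of integers of `K` is totally positive if `σ α > 0`
for every real embedding `σ : K →+* ℝ`. -/
def TotallyPositive (K : Type*) [Field K] (α : 𝓞 K) : Prop :=
  ∀ σ : K →+* ℝ, 0 < σ (α : K)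

/-- A totally positive integer is indecomposable if it is not the sum of two
totally positive integers. -/
def Indecomposable (K : Type*) [Field K] (α : 𝓞 K) : Prop :=
  ¬ ∃ β γ : 𝓞 K, TotallyPositive K β ∧ TotallyPositive K γ ∧ α = β + γ

open Polynomial in
/-- The iterates of `X ^ 2 - 2`, whose `m`-th member sends `2 cos t` to `2 cos (2 ^ m t)`. -/
noncomputable def cosDoubling : ℕ → ℤ[X]
  | 0 => X
  | m + 1 => cosDoubling m ^ 2 - 2

open Polynomial in
lemma cosDoubling_monic_natDegree (m : ℕ) :
    (cosDoubling m).Monic ∧ (cosDoubling m).natDegree = 2 ^ m := by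
  induction m with
  | zero => exact ⟨monic_X, by simp [cosDoubling]⟩
  | succ m ih =>
    have hdeg : (cosDoubling m ^ 2).natDegree = 2 ^ (m + 1) := by
      rw [ih.1.natDegree_pow, ih.2, pow_succ, mul_comm]
    have hlt : (2 : ℤ[X]).natDegree < (cosDoubling m ^ 2).natDegree := by
      rw [hdeg, natDegree_ofNat]; positivity
    refine ⟨(ih.1.pow 2).sub_of_left (degree_lt_degree hlt), ?_⟩
    rw [cosDoubling, natDegree_sub_eq_left_of_natDegree_lt hlt, hdeg]

open Polynomial in
lemma aeval_cosDoubling (m : ℕ) (t : ℝ) :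
    aeval (2 * Real.cos t) (cosDoubling m) = 2 * Real.cos (2 ^ m * t) := by
  induction m with
  | zero => simp [cosDoubling]
  | succ m ih =>
    rw [cosDoubling, map_sub, map_pow, ih, map_ofNat, pow_succ' (2 : ℝ) m, mul_assoc,
      Real.cos_two_mul]
    ring

open Polynomial in
lemma cosDoubling_coeff_zero (m : ℕ) :
    (cosDoubling (m + 1)).coeff 0 = 2 ∨ (cosDoubling (m + 1)).coeff 0 = -2 := by
  induction m with
  | zero => right; simp [cosDoubling, coeff_zero_eq_eval_zero]
  | succ m ih =>
    left
    rw [cosDoubling]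
    simp only [coeff_zero_eq_eval_zero, eval_sub, eval_pow, eval_ofNat] at ih ⊢
    rcases ih with h | h <;> rw [h] <;> norm_num

open Polynomial in
lemma cosDoubling_map_zmod (m : ℕ) :
    (cosDoubling m).map (Int.castRingHom (ZMod 2)) = X ^ 2 ^ m := by
  induction m with
  | zero => simp [cosDoubling]
  | succ m ih =>
    have h : (2 : (ZMod 2)[X]) = 0 := CharTwo.two_eq_zero
    rw [cosDoubling, Polynomial.map_sub, Polynomial.map_pow, ih, Polynomial.map_ofNat, h, sub_zero,
      ← pow_mul, pow_succ]

open Polynomial in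
lemma cosDoubling_isEisensteinAt (m : ℕ) :
    (cosDoubling (m + 1)).IsEisensteinAt (Ideal.span {(2 : ℤ)}) where
  leading := by
    rw [(cosDoubling_monic_natDegree _).1.leadingCoeff, Ideal.mem_span_singleton]
    norm_num
  mem := by
    intro k hk
    rw [(cosDoubling_monic_natDegree _).2] at hk
    have h := congrArg (fun p => coeff p k) (cosDoubling_map_zmod (m + 1))
    simp only [coeff_map, coeff_X_pow, hk.ne, if_false] at h
    rw [Ideal.mem_span_singleton]
    exact (ZMod.intCast_zmod_eq_zero_iff_dvd _ 2).1 h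
  notMem := by
    rw [Ideal.span_singleton_pow, Ideal.mem_span_singleton]
    rcases cosDoubling_coeff_zero m with h | h <;> rw [h] <;> norm_num

/-- The odd multiples `(4 j + 1) π / (2 d)` with `d = 2 ^ m`; the conjugates of `2 cos (π / (2 d))`
are `2 cos (oddAngle m j)` for `j < d`. -/
noncomputable def oddAngle (m j : ℕ) : ℝ := (4 * j + 1) * (Real.pi / (2 * 2 ^ m))

lemma two_pow_mul_oddAngle (m j : ℕ) :
    2 ^ m * oddAngle m j = Real.pi / 2 + j * (2 * Real.pi) := by
  rw [oddAngle]; field_simp; ring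

open Polynomial in
lemma aeval_cosDoubling_oddAngle (m j : ℕ) :
    aeval (2 * Real.cos (oddAngle m j)) (cosDoubling m) = 0 := by
  rw [aeval_cosDoubling, two_pow_mul_oddAngle, Real.cos_add_nat_mul_two_pi, Real.cos_pi_div_two,
    mul_zero]

lemma sin_oddAngle_ne_zero (m j : ℕ) : Real.sin (oddAngle m j) ≠ 0 := by
  intro h
  obtain ⟨k, hk⟩ := Real.sin_eq_zero_iff.1 h
  have h2 := congrArg Real.cos (two_pow_mul_oddAngle m j)
  rw [Real.cos_add_nat_mul_two_pi, Real.cos_pi_div_two, ← hk, ← mul_assoc,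
    show (2 : ℝ) ^ m * k = ((2 ^ m * k : ℤ) : ℝ) by push_cast; rfl, Real.cos_int_mul_pi] at h2
  exact zpow_ne_zero _ (by norm_num) h2

lemma cos_oddAngle_injective (m : ℕ) :
    Function.Injective fun j : Fin (2 ^ m) => 2 * Real.cos (oddAngle m j) := by
  intro i j h
  have h' : Real.cos (oddAngle m i) = Real.cos (oddAngle m j) := by
    simpa using h
  obtain ⟨k, hk | hk⟩ := Real.cos_eq_cos_iff.1 h'
  · have h1 : (4 * (j : ℕ) + 1 : ℝ) = 4 * k * 2 ^ m + (4 * (i : ℕ) + 1) := by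
      rw [oddAngle, oddAngle] at hk
      field_simp at hk
      linarith
    have h2 : (4 * (j : ℕ) + 1 : ℤ) = 4 * k * 2 ^ m + (4 * (i : ℕ) + 1) := by exact_mod_cast h1
    have hi : ((i : ℕ) : ℤ) < 2 ^ m := by exact_mod_cast i.2
    have hj : ((j : ℕ) : ℤ) < 2 ^ m := by exact_mod_cast j.2
    have hk0 : k = 0 := by
      rcases lt_trichotomy k 0 with hk | hk | hk
      · nlinarith
      · exact hk
      · nlinarith
    subst hk0
    apply Fin.ext
    omega
  · have h1 : (4 * (j : ℕ) + 1 : ℝ) = 4 * k * 2 ^ m - (4 * (i : ℕ) + 1) := by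
      rw [oddAngle, oddAngle] at hk
      field_simp at hk
      linarith
    have h2 : (4 * (j : ℕ) + 1 : ℤ) = 4 * (k * 2 ^ m) - (4 * (i : ℕ) + 1) := by
      rw [← mul_assoc]; exact_mod_cast h1
    omega

/-- The generator `2 cos (2 π / q)` of `Kq q`. -/
noncomputable def Kq.gen (q : ℕ) : Kq q :=
  IntermediateField.AdjoinSimple.gen ℚ (2 * Real.cos (2 * Real.pi / q))

lemma Kq.coe_gen (m : ℕ) : (Kq.gen (2 ^ (m + 2)) : ℝ) = 2 * Real.cos (oddAngle m 0) := by
  rw [Kq.gen, IntermediateField.AdjoinSimple.coe_gen, oddAngle]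
  congr 2
  push_cast
  rw [pow_add]
  field_simp
  ring

open Polynomial in
lemma Kq.aeval_gen (m : ℕ) : aeval (Kq.gen (2 ^ (m + 2))) (cosDoubling m) = 0 := by
  apply (algebraMap (Kq (2 ^ (m + 2))) ℝ).injective
  rw [map_zero, ← aeval_algebraMap_apply]
  change aeval (Kq.gen (2 ^ (m + 2)) : ℝ) (cosDoubling m) = 0
  rw [Kq.coe_gen, aeval_cosDoubling_oddAngle]

open Polynomial in
lemma Kq.isIntegral_gen (m : ℕ) : IsIntegral ℤ (Kq.gen (2 ^ (m + 2))) :=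
  ⟨_, (cosDoubling_monic_natDegree m).1, Kq.aeval_gen m⟩

open Polynomial in
lemma Kq.minpoly_int_gen (m : ℕ) :
    minpoly ℤ (Kq.gen (2 ^ (m + 3))) = cosDoubling (m + 1) := by
  have hmon := (cosDoubling_monic_natDegree (m + 1)).1
  have hirr : Irreducible (cosDoubling (m + 1)) :=
    (cosDoubling_isEisensteinAt m).irreducible
      ((Ideal.span_singleton_prime two_ne_zero).2 Int.prime_two) hmon.isPrimitive
      (by rw [(cosDoubling_monic_natDegree _).2]; positivity)
  have hint := Kq.isIntegral_gen (m + 1)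
  exact eq_of_monic_of_associated (minpoly.monic hint) hmon
    ((minpoly.irreducible hint).associated_of_dvd hirr
      (minpoly.isIntegrallyClosed_dvd hint (Kq.aeval_gen (m + 1))))

open Polynomial in
lemma Kq.minpoly_rat_gen (m : ℕ) :
    minpoly ℚ (Kq.gen (2 ^ (m + 3))) = (cosDoubling (m + 1)).map (algebraMap ℤ ℚ) := by
  rw [← Kq.minpoly_int_gen]
  exact minpoly.isIntegrallyClosed_eq_field_fractions' ℚ (Kq.isIntegral_gen (m + 1))

open Polynomial in
lemma isIntegral_two_mul_cos (m : ℕ) :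
    IsIntegral ℚ (2 * Real.cos (2 * Real.pi / (2 ^ (m + 2) : ℕ))) := by
  refine ⟨(cosDoubling m).map (algebraMap ℤ ℚ), (cosDoubling_monic_natDegree m).1.map _, ?_⟩
  rw [← aeval_def, aeval_map_algebraMap]
  change aeval (Kq.gen (2 ^ (m + 2)) : ℝ) (cosDoubling m) = 0
  rw [Kq.coe_gen, aeval_cosDoubling_oddAngle]

open Polynomial in
/-- The real embedding of `Kq (2 ^ (m + 3))` indexed by `4 j + 1`. -/
noncomputable def Kq.embedding (m j : ℕ) : Kq (2 ^ (m + 3)) →ₐ[ℚ] ℝ :=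
  (IntermediateField.adjoin.powerBasis (isIntegral_two_mul_cos (m + 1))).lift
    (2 * Real.cos (oddAngle (m + 1) j)) (by
      change aeval _ (minpoly ℚ (Kq.gen (2 ^ (m + 3)))) = 0
      rw [Kq.minpoly_rat_gen, aeval_map_algebraMap, aeval_cosDoubling_oddAngle])

lemma Kq.embedding_gen (m j : ℕ) :
    Kq.embedding m j (Kq.gen (2 ^ (m + 3))) = 2 * Real.cos (oddAngle (m + 1) j) :=
  (IntermediateField.adjoin.powerBasis (isIntegral_two_mul_cos (m + 1))).lift_gen _ _

lemma Kq.finiteDimensional (m : ℕ) : FiniteDimensional ℚ (Kq (2 ^ (m + 3))) :=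
  IntermediateField.adjoin.finiteDimensional (isIntegral_two_mul_cos (m + 1))

lemma Kq.finrank (m : ℕ) : Module.finrank ℚ (Kq (2 ^ (m + 3))) = 2 ^ (m + 1) := by
  have hmon := cosDoubling_monic_natDegree (m + 1)
  have h := IntermediateField.adjoin.finrank (isIntegral_two_mul_cos (m + 1))
  rw [← IntermediateField.minpoly_gen] at h
  refine h.trans ((congrArg Polynomial.natDegree (Kq.minpoly_rat_gen m)).trans ?_)
  rw [hmon.1.natDegree_map, hmon.2]

/-- The embeddings `Kq.embedding m j`, viewed as complex embeddings, for `j < 2 ^ (m + 1)`. -/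
noncomputable def Kq.complexEmbedding (m : ℕ) (j : Fin (2 ^ (m + 1))) :
    Kq (2 ^ (m + 3)) →ₐ[ℚ] ℂ :=
  (Complex.ofRealAm.restrictScalars ℚ).comp (Kq.embedding m j)

lemma Kq.complexEmbedding_apply (m : ℕ) (j : Fin (2 ^ (m + 1))) (x : Kq (2 ^ (m + 3))) :
    Kq.complexEmbedding m j x = (Kq.embedding m j x : ℂ) := rfl

lemma Kq.complexEmbedding_bijective (m : ℕ) : Function.Bijective (Kq.complexEmbedding m) := by
  have := Kq.finiteDimensional m
  rw [Fintype.bijective_iff_injective_and_card]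
  constructor
  · intro i j h
    apply cos_oddAngle_injective
    have := congrArg (fun σ => σ (Kq.gen (2 ^ (m + 3)))) h
    simp only [Kq.complexEmbedding_apply, Kq.embedding_gen] at this
    exact_mod_cast this
  · rw [AlgHom.card, Kq.finrank, Fintype.card_fin]

lemma Kq.exists_eq_embedding (m : ℕ) (τ : Kq (2 ^ (m + 3)) →+* ℝ) :
    ∃ j : Fin (2 ^ (m + 1)), ∀ x, τ x = Kq.embedding m j x := by
  obtain ⟨j, hj⟩ := (Kq.complexEmbedding_bijective m).2
    ((Complex.ofRealAm.restrictScalars ℚ).comp τ.toRatAlgHom)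
  refine ⟨j, fun x => ?_⟩
  have := congrArg (fun σ => σ x) hj
  exact (Complex.ofReal_injective this).symm

lemma Kq.norm_eq_prod (m : ℕ) (x : Kq (2 ^ (m + 3))) :
    (Algebra.norm ℚ x : ℝ) = ∏ j : Fin (2 ^ (m + 1)), Kq.embedding m j x := by
  have := Kq.finiteDimensional m
  have h := Algebra.norm_eq_prod_embeddings ℚ ℂ x
  rw [← (Kq.complexEmbedding_bijective m).prod_comp (fun σ => σ x)] at h
  simp only [Kq.complexEmbedding_apply] at h
  rw [eq_ratCast] at h
  exact_mod_cast h

lemma Kq.exists_int_prod (m : ℕ) (x : 𝓞 (Kq (2 ^ (m + 3)))) :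
    ∃ z : ℤ, (z : ℝ) = ∏ j : Fin (2 ^ (m + 1)), Kq.embedding m j x := by
  have := Kq.finiteDimensional m
  obtain ⟨z, hz⟩ := IsIntegrallyClosed.isIntegral_iff.1 (Algebra.isIntegral_norm ℚ x.isIntegral_coe)
  refine ⟨z, ?_⟩
  rw [← Kq.norm_eq_prod, ← hz]
  simp

lemma Kq.embedding_eq_of_coe_eq (m j : ℕ) (x : Kq (2 ^ (m + 3)))
    (hx : (x : ℝ) = (omegaJReal (2 ^ (m + 3)) 1 + 2) *
      (omegaJReal (2 ^ (m + 3)) 1 + omegaJReal (2 ^ (m + 3)) (2 ^ (m + 1) - 1) + 3)) :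
    Kq.embedding m j x = (2 * Real.cos (oddAngle (m + 1) j) + 2) *
      (2 * Real.cos (oddAngle (m + 1) j) + 2 * Real.sin (oddAngle (m + 1) j) + 3) := by
  set k : ℤ := 2 ^ (m + 1) - 1 with hk
  set g := Kq.gen (2 ^ (m + 3)) with hg
  have hcos : ∀ i : ℕ, Polynomial.aeval (2 * Real.cos (oddAngle (m + 1) i))
      (Polynomial.Chebyshev.C ℤ k) = 2 * Real.sin (oddAngle (m + 1) i) := by
    intro i
    have h2 := two_pow_mul_oddAngle (m + 1) i
    rw [Polynomial.Chebyshev.aeval_C, Polynomial.Chebyshev.C_two_mul_real_cos, hk]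
    push_cast
    rw [sub_mul, one_mul, h2, add_sub_right_comm, Real.cos_add_nat_mul_two_pi,
      Real.cos_pi_div_two_sub]
  have hgcoe : (g : ℝ) = 2 * Real.cos (oddAngle (m + 1) 0) := Kq.coe_gen (m + 1)
  have homega1 : omegaJReal (2 ^ (m + 3)) 1 = g := by
    rw [omegaJReal, Nat.cast_one, mul_one]; rfl
  have homega2 : omegaJReal (2 ^ (m + 3)) (2 ^ (m + 1) - 1) =
      (Polynomial.aeval g (Polynomial.Chebyshev.C ℤ k) : Kq (2 ^ (m + 3))) := by
    have h1 : ((Polynomial.aeval g (Polynomial.Chebyshev.C ℤ k) : Kq (2 ^ (m + 3))) : ℝ) =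
      Polynomial.aeval (g : ℝ) (Polynomial.Chebyshev.C ℤ k) :=
      (Polynomial.aeval_algebraMap_apply ℝ g (Polynomial.Chebyshev.C ℤ k)).symm
    rw [h1, hgcoe, Polynomial.Chebyshev.aeval_C, Polynomial.Chebyshev.C_two_mul_real_cos, hk,
      omegaJReal, oddAngle]
    push_cast [Nat.one_le_two_pow]
    congr 2
    rw [pow_add, pow_add]
    field_simp
    ring
  have hxg : x = (g + 2) * (g + Polynomial.aeval g (Polynomial.Chebyshev.C ℤ k) + 3) := by
    apply Subtype.ext
    rw [hx, homega1, homega2]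
    rfl
  have hmap : Kq.embedding m j (Polynomial.aeval g (Polynomial.Chebyshev.C ℤ k)) =
      Polynomial.aeval (Kq.embedding m j g) (Polynomial.Chebyshev.C ℤ k) :=
    (Polynomial.aeval_algHom_apply ((Kq.embedding m j).restrictScalars ℤ) g _).symm
  rw [hxg, map_mul, map_add, map_add, map_add, hmap, hg, Kq.embedding_gen, hcos, map_ofNat,
    map_ofNat]

lemma two_mul_cos_add_pos (t : ℝ) : 0 < 2 * Real.cos t + 2 * Real.sin t + 3 := by
  nlinarith [Real.sin_sq_add_cos_sq t, sq_nonneg (Real.cos t + Real.sin t + 1),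
    sq_nonneg (Real.cos t - Real.sin t)]

lemma prod_one_add_mul_exp_oddAngle (m : ℕ) (c : ℂ) :
    ∏ j : Fin (2 ^ (m + 1)), (1 + c * Complex.exp (oddAngle (m + 1) j * Complex.I)) =
      1 - c ^ 2 ^ (m + 1) * Complex.I := by
  have hd : (2 : ℕ) ^ (m + 1) ≠ 0 := by positivity
  have hζ := Complex.isPrimitiveRoot_exp _ hd
  have he : (-c * Complex.exp (oddAngle (m + 1) 0 * Complex.I)) ^ 2 ^ (m + 1) =
      c ^ 2 ^ (m + 1) * Complex.I := by
    rw [mul_pow, Even.neg_pow (Nat.even_pow.2 ⟨even_two, by omega⟩), ← Complex.exp_nat_mul]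
    congr 1
    have h := two_pow_mul_oddAngle (m + 1) 0
    rw [← mul_assoc, ← Complex.ofReal_natCast, ← Complex.ofReal_mul, Nat.cast_pow, Nat.cast_ofNat,
      h, Nat.cast_zero, zero_mul, add_zero]
    push_cast
    exact Complex.exp_pi_div_two_mul_I
  have h := congrArg (Polynomial.eval 1) (X_pow_sub_C_eq_prod hζ (Nat.pos_of_ne_zero hd) he)
  rw [Polynomial.eval_prod] at h
  simp only [Polynomial.eval_sub, Polynomial.eval_pow, Polynomial.eval_X, Polynomial.eval_C,
    one_pow] at h
  rw [h, Finset.prod_range]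
  refine Finset.prod_congr rfl fun j _ => ?_
  rw [← Complex.exp_nat_mul, mul_left_comm, ← Complex.exp_add, neg_mul, sub_neg_eq_add]
  congr 3
  rw [oddAngle, oddAngle]
  push_cast
  field_simp
  ring

lemma prod_embedding_eq (m : ℕ) (hm : 1 ≤ m) :
    ∏ j : Fin (2 ^ (m + 1)), ((2 * Real.cos (oddAngle (m + 1) j) + 2) *
      (2 * Real.cos (oddAngle (m + 1) j) + 2 * Real.sin (oddAngle (m + 1) j) + 3)) =
      2 * (2 ^ 2 ^ (m + 1) + 1) := by
  have hnormSq : ∀ t : ℝ, (2 * Real.cos t + 2) * (2 * Real.cos t + 2 * Real.sin t + 3) =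
      Complex.normSq (1 + 1 * Complex.exp (t * Complex.I)) *
        Complex.normSq (1 + (1 - Complex.I) * Complex.exp (t * Complex.I)) := by
    intro t
    simp only [Complex.exp_mul_I, ← Complex.ofReal_cos, ← Complex.ofReal_sin, Complex.normSq_apply]
    simp [-Complex.ofReal_cos, -Complex.ofReal_sin]
    linear_combination (2 * Real.cos t + 2) * (-2) * Real.sin_sq_add_cos_sq t +
      (-(1 + 2 * (Real.cos t + Real.sin t) + 2 * (Real.cos t ^ 2 + Real.sin t ^ 2))) *
        Real.sin_sq_add_cos_sq t
  simp only [hnormSq]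
  rw [Finset.prod_mul_distrib, ← map_prod, ← map_prod, prod_one_add_mul_exp_oddAngle,
    prod_one_add_mul_exp_oddAngle]
  obtain ⟨k, rfl⟩ := Nat.exists_eq_add_of_le' hm
  have hc : (1 - Complex.I) ^ 2 ^ (k + 1 + 1) = ((-4 : ℝ) ^ 2 ^ k : ℝ) := by
    rw [show (2 : ℕ) ^ (k + 1 + 1) = 4 * 2 ^ k by ring, pow_mul]
    push_cast
    congr 1
    linear_combination (Complex.I ^ 2 - 4 * Complex.I + 5) * Complex.I_sq
  have h4 : ((-4 : ℝ) ^ 2 ^ k) * ((-4 : ℝ) ^ 2 ^ k) = 2 ^ 2 ^ (k + 1 + 1) := by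
    rw [← mul_pow, show (2 : ℕ) ^ (k + 1 + 1) = 4 * 2 ^ k by ring, pow_mul]
    norm_num
  rw [hc, one_pow, Complex.normSq_apply, Complex.normSq_apply]
  simp only [Complex.sub_re, Complex.sub_im, Complex.one_re, Complex.one_im, Complex.re_ofReal_mul,
    Complex.im_ofReal_mul, Complex.I_re, Complex.I_im, one_mul]
  linear_combination 2 * h4

lemma five_pow_mul_prod_le {ι : Type*} (s : Finset ι) (x y : ι → ℝ) (hx : ∀ i ∈ s, 0 ≤ x i)
    (hy : ∀ i ∈ s, 0 ≤ y i) :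
    (5 ^ s.card) ^ 5 * ((∏ i ∈ s, x i) * (∏ i ∈ s, y i) ^ 4) ≤
      (∏ i ∈ s, (x i + 4 * y i)) ^ 5 := by
  have key : ∀ a b : ℝ, 0 ≤ a → 0 ≤ b → 5 ^ 5 * (a * b ^ 4) ≤ (a + 4 * b) ^ 5 := by
    intro a b ha hb
    have : 0 ≤ (a - b) ^ 2 * (a ^ 3 + 22 * a ^ 2 * b + 203 * a * b ^ 2 + 1024 * b ^ 3) := by
      positivity
    linarith
  rw [← pow_mul, mul_comm s.card, pow_mul, ← Finset.prod_const, ← Finset.prod_pow,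
    ← Finset.prod_pow, ← Finset.prod_mul_distrib, ← Finset.prod_mul_distrib]
  refine Finset.prod_le_prod (fun i hi => ?_) fun i hi => key _ _ (hx i hi) (hy i hi)
  have := hx i hi
  have := hy i hi
  positivity

lemma not_two_pow_dvd {d : ℕ} (hd : 2 ≤ d) : ¬ (2 : ℤ) ^ d ∣ 2 * (2 ^ d + 1) := by
  intro h
  have h2 : (2 : ℤ) ^ d ∣ 2 := by
    have h3 : (2 : ℤ) ^ d ∣ 2 * 2 ^ d := dvd_mul_left _ _
    have := dvd_sub h h3
    rwa [mul_add, mul_one, add_sub_cancel_left] at this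
  have h4 : (2 : ℤ) ^ 2 ∣ 2 := (pow_dvd_pow 2 hd).trans h2
  norm_num at h4

lemma norm_inequality_of_add_eq (m : ℕ) (hm : 1 ≤ m) (β γ : 𝓞 (Kq (2 ^ (m + 3))))
    (hβ : TotallyPositive _ β) (hγ : TotallyPositive _ γ)
    (hprod : ∏ j : Fin (2 ^ (m + 1)), Kq.embedding m j (β + γ : Kq (2 ^ (m + 3))) =
      2 * (2 ^ 2 ^ (m + 1) + 1)) :
    ∃ z w v : ℤ, (z : ℝ) = ∏ j : Fin (2 ^ (m + 1)), Kq.embedding m j (β - γ : Kq (2 ^ (m + 3))) ∧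
      (w : ℝ) = ∏ j : Fin (2 ^ (m + 1)), Kq.embedding m j β ∧
      (v : ℝ) = ∏ j : Fin (2 ^ (m + 1)), Kq.embedding m j γ ∧
      z ≠ 0 ∧ 0 < w ∧ 0 < v ∧
      (5 ^ 2 ^ (m + 1)) ^ 5 * (z ^ 2 * (w * v) ^ 4) ≤ ((2 * (2 ^ 2 ^ (m + 1) + 1)) ^ 2) ^ 5 := by
  obtain ⟨z, hz⟩ := Kq.exists_int_prod m (β - γ)
  obtain ⟨w, hw⟩ := Kq.exists_int_prod m β
  obtain ⟨v, hv⟩ := Kq.exists_int_prod m γ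
  change _ = ∏ j : Fin (2 ^ (m + 1)), Kq.embedding m j (β - γ : Kq (2 ^ (m + 3))) at hz
  have hβ' : ∀ j, 0 < Kq.embedding m j β := fun j => hβ (Kq.embedding m j).toRingHom
  have hγ' : ∀ j, 0 < Kq.embedding m j γ := fun j => hγ (Kq.embedding m j).toRingHom
  refine ⟨z, w, v, hz, hw, hv, ?_, ?_, ?_, ?_⟩
  · rintro rfl
    rw [Int.cast_zero, eq_comm, Finset.prod_eq_zero_iff] at hz
    obtain ⟨j, -, hj⟩ := hz
    have h0 := sub_eq_zero.1 ((map_eq_zero _).1 hj)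
    rw [← h0, ← two_mul] at hprod
    simp only [map_mul, map_ofNat, Finset.prod_mul_distrib, Finset.prod_const, Finset.card_univ,
      Fintype.card_fin] at hprod
    rw [← hw] at hprod
    have hdvd : (2 : ℤ) ^ 2 ^ (m + 1) * w = 2 * (2 ^ 2 ^ (m + 1) + 1) := by exact_mod_cast hprod
    exact not_two_pow_dvd (Nat.lt_two_pow_self.trans_le' (by omega)).le ⟨w, hdvd.symm⟩
  · have : (0 : ℝ) < w := hw ▸ Finset.prod_pos fun j _ => hβ' j
    exact_mod_cast this
  · have : (0 : ℝ) < v := hv ▸ Finset.prod_pos fun j _ => hγ' j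
    exact_mod_cast this
  · have h := five_pow_mul_prod_le Finset.univ
      (fun j : Fin (2 ^ (m + 1)) => Kq.embedding m j (β - γ : Kq (2 ^ (m + 3))) ^ 2)
      (fun j => Kq.embedding m j β * Kq.embedding m j γ) (fun j _ => sq_nonneg _)
      (fun j _ => (mul_pos (hβ' j) (hγ' j)).le)
    have hsum : ∀ j : Fin (2 ^ (m + 1)), Kq.embedding m j (β - γ : Kq (2 ^ (m + 3))) ^ 2 +
        4 * (Kq.embedding m j β * Kq.embedding m j γ) =
        Kq.embedding m j (β + γ : Kq (2 ^ (m + 3))) ^ 2 := by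
      intro j
      rw [map_sub, map_add]
      ring
    simp only [hsum] at h
    rw [Finset.prod_pow, Finset.prod_pow, Finset.prod_mul_distrib, hprod, ← hz, ← hw, ← hv,
      Finset.card_univ, Fintype.card_fin] at h
    exact_mod_cast h

lemma sq_two_mul_two_pow_add_one_lt {d : ℕ} (hd : 8 ≤ d) :
    (2 * (2 ^ d + 1)) ^ 2 < (5 : ℤ) ^ d := by
  induction d, hd using Nat.le_induction with
  | base => norm_num
  | succ d _ ih =>
    have : (0 : ℤ) < 2 ^ d := by positivity
    rw [pow_succ (2 : ℤ), pow_succ (5 : ℤ)]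
    nlinarith

lemma not_add_of_two_le (m : ℕ) (hm : 2 ≤ m) (β γ : 𝓞 (Kq (2 ^ (m + 3))))
    (hβ : TotallyPositive _ β) (hγ : TotallyPositive _ γ)
    (hprod : ∏ j : Fin (2 ^ (m + 1)), Kq.embedding m j (β + γ : Kq (2 ^ (m + 3))) =
      2 * (2 ^ 2 ^ (m + 1) + 1)) : False := by
  obtain ⟨z, w, v, -, -, -, hz, hw, hv, h⟩ :=
    norm_inequality_of_add_eq m (by omega) β γ hβ hγ hprod
  have hd : 8 ≤ 2 ^ (m + 1) := Nat.pow_le_pow_right two_pos (show 3 ≤ m + 1 by omega)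
  have h1 := pow_lt_pow_left₀ (sq_two_mul_two_pow_add_one_lt hd) (by positivity) (n := 5)
    (by norm_num)
  have hwv : 0 < w * v := mul_pos hw hv
  have h2 : 1 ≤ z ^ 2 * (w * v) ^ 4 :=
    Int.add_one_le_iff.2 (mul_pos (sq_pos_iff.2 hz) (pow_pos hwv 4))
  have h3 := le_mul_of_one_le_right (show (0 : ℤ) ≤ (5 ^ 2 ^ (m + 1)) ^ 5 by positivity) h2
  linarith

/-- The norm form of `ℤ[2 cos (π / 8)]` in the power basis is
`U ^ 2 + 4 * U * V + 2 * V ^ 2` for these quadratic forms `U` and `V`. -/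
def normFormU (s t u v : ℤ) : ℤ := s ^ 2 - 2 * u ^ 2 + 4 * t * v + 8 * v ^ 2

/-- See `normFormU`. -/
def normFormV (s t u v : ℤ) : ℤ := 2 * s * u + 4 * u ^ 2 - t ^ 2 - 8 * t * v - 14 * v ^ 2

lemma cosDoubling_two : cosDoubling 2 = Polynomial.X ^ 4 - 4 * Polynomial.X ^ 2 + 2 := by
  simp only [cosDoubling]
  ring

/-- The integral linear combination of the powers of the generator of `Kq 16` with the given
coordinates. -/
noncomputable def Kq.ofCoordinates (s t u v : ℤ) : Kq (2 ^ (1 + 3)) :=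
  (s : Kq (2 ^ (1 + 3))) + (t : Kq (2 ^ (1 + 3))) * Kq.gen (2 ^ (1 + 3)) +
    (u : Kq (2 ^ (1 + 3))) * Kq.gen (2 ^ (1 + 3)) ^ 2 +
    (v : Kq (2 ^ (1 + 3))) * Kq.gen (2 ^ (1 + 3)) ^ 3

lemma Kq.prod_embedding_sixteen (s t u v : ℤ) :
    ∏ j : Fin (2 ^ (1 + 1)), Kq.embedding 1 j (Kq.ofCoordinates s t u v) =
      (normFormU s t u v ^ 2 + 4 * normFormU s t u v * normFormV s t u v +
        2 * normFormV s t u v ^ 2 : ℤ) := by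
  simp only [Kq.ofCoordinates, map_add, map_mul, map_pow, map_intCast, Kq.embedding_gen]
  set a := 2 * Real.cos (Real.pi / 8) with ha
  set b := 2 * Real.sin (Real.pi / 8) with hb
  have h0 : 2 * Real.cos (oddAngle (1 + 1) 0) = a := by
    rw [ha, oddAngle]; norm_num
  have h1 : 2 * Real.cos (oddAngle (1 + 1) 1) = -b := by
    rw [hb, ← mul_neg, ← Real.cos_add_pi_div_two, oddAngle]
    congr 2; push_cast; ring
  have h2 : 2 * Real.cos (oddAngle (1 + 1) 2) = -a := by
    rw [ha, ← mul_neg, ← Real.cos_add_pi, oddAngle]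
    congr 2; push_cast; ring
  have h3 : 2 * Real.cos (oddAngle (1 + 1) 3) = b := by
    rw [hb, ← Real.sin_add_two_pi, ← Real.cos_sub_pi_div_two, oddAngle]
    congr 2; push_cast; ring
  have hab : b ^ 2 = 4 - a ^ 2 := by
    rw [ha, hb]; linear_combination 4 * Real.sin_sq_add_cos_sq (Real.pi / 8)
  have ha4 : a ^ 4 - 4 * a ^ 2 + 2 = 0 := by
    have h := aeval_cosDoubling_oddAngle 2 0
    rw [h0, cosDoubling_two] at h
    simpa only [map_add, map_sub, map_mul, map_pow, Polynomial.aeval_X, map_ofNat] using h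
  change ∏ j : Fin 4, _ = _
  rw [Fin.prod_univ_four]
  simp only [Fin.val_zero, Fin.val_one, Fin.val_two, show ((3 : Fin 4) : ℕ) = 3 from rfl, h0, h1,
    h2, h3]
  have hpair : ∀ x : ℝ, x ^ 4 - 4 * x ^ 2 + 2 = 0 →
      (s + t * x + u * x ^ 2 + v * x ^ 3) * (s + t * (-x) + u * (-x) ^ 2 + v * (-x) ^ 3) =
      normFormU s t u v + normFormV s t u v * x ^ 2 := by
    intro x hx
    rw [normFormU, normFormV]
    push_cast
    linear_combination (u ^ 2 - 2 * t * v - 4 * v ^ 2 - v ^ 2 * x ^ 2 : ℝ) * hx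
  have hb4 : b ^ 4 - 4 * b ^ 2 + 2 = 0 := by
    rw [show b ^ 4 = (b ^ 2) ^ 2 by ring, hab]
    linear_combination ha4
  have hpa := hpair a ha4
  have hpb := hpair b hb4
  calc _ = ((s + t * a + u * a ^ 2 + v * a ^ 3) * (s + t * (-a) + u * (-a) ^ 2 + v * (-a) ^ 3)) *
        ((s + t * b + u * b ^ 2 + v * b ^ 3) * (s + t * (-b) + u * (-b) ^ 2 + v * (-b) ^ 3)) := by
        ring
    _ = _ := by
      rw [hpa, hpb, hab]
      push_cast
      linear_combination (-(normFormV s t u v : ℝ) ^ 2) * ha4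

open Polynomial in
lemma Kq.mem_adjoin_sixteen (x : 𝓞 (Kq (2 ^ (1 + 3)))) :
    (x : Kq (2 ^ (1 + 3))) ∈ Algebra.adjoin ℤ {Kq.gen (2 ^ (1 + 3))} := by
  have := Kq.finiteDimensional 1
  let B : PowerBasis ℚ (Kq (2 ^ (1 + 3))) :=
    IntermediateField.adjoin.powerBasis (isIntegral_two_mul_cos (1 + 1))
  have hB : B.gen = Kq.gen (2 ^ (1 + 3)) := rfl
  have hint : IsIntegral ℤ B.gen := Kq.isIntegral_gen (1 + 1)
  have hdisc : Algebra.discr ℚ B.basis = 2 ^ 11 := by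
    have hnorm : Algebra.norm ℚ (aeval B.gen (derivative (minpoly ℚ B.gen))) = 2 ^ 11 := by
      have hder : aeval B.gen (derivative (minpoly ℚ B.gen)) =
          Kq.ofCoordinates 0 (-8) 0 4 := by
        rw [hB, Kq.minpoly_rat_gen, cosDoubling_two, derivative_map, aeval_map_algebraMap,
          Kq.ofCoordinates]
        simp only [derivative_mul, derivative_X_pow, derivative_ofNat,
          map_add, map_sub, map_mul, map_pow, aeval_X, map_ofNat, map_zero,
          map_natCast]
        push_cast
        ring
      have h := Kq.norm_eq_prod 1 (aeval B.gen (derivative (minpoly ℚ B.gen)))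
      rw [hder, Kq.prod_embedding_sixteen] at h
      rw [hder]
      norm_num [normFormU, normFormV] at h ⊢
      exact Rat.cast_injective (α := ℝ) (by simpa using h)
    rw [Algebra.discr_powerBasis_eq_norm, hnorm, Kq.finrank]
    norm_num
  have hmem := Algebra.discr_mul_isIntegral_mem_adjoin ℚ hint x.isIntegral_coe
  rw [hdisc] at hmem
  refine mem_adjoin_of_smul_prime_pow_smul_of_minpoly_isEisensteinAt (B := B) (n := 11)
    Int.prime_two hint x.isIntegral_coe ?_ ?_
  · convert hmem using 1
    rw [Algebra.smul_def, Algebra.smul_def]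
    simp only [map_pow, map_ofNat]
  · rw [hB, Kq.minpoly_int_gen]
    exact cosDoubling_isEisensteinAt 1

open Polynomial in
lemma Kq.exists_coordinates_sixteen (x : 𝓞 (Kq (2 ^ (1 + 3)))) :
    ∃ s t u v : ℤ, (x : Kq (2 ^ (1 + 3))) = Kq.ofCoordinates s t u v := by
  have h := Kq.mem_adjoin_sixteen x
  rw [Algebra.adjoin_singleton_eq_range_aeval] at h
  obtain ⟨p, hp⟩ := h
  obtain ⟨hmon, hdeg⟩ := cosDoubling_monic_natDegree 2
  set r := p %ₘ cosDoubling 2 with hr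
  have hpr : aeval (Kq.gen (2 ^ (1 + 3))) r = (x : Kq (2 ^ (1 + 3))) := by
    rw [← hp]
    change _ = aeval _ p
    conv_rhs => rw [← modByMonic_add_div p (cosDoubling 2), map_add, map_mul]
    rw [Kq.aeval_gen 2, zero_mul, add_zero]
  have hrdeg : r.natDegree < 4 := by
    have := natDegree_modByMonic_lt p hmon (by rintro h1; rw [h1] at hdeg; simp at hdeg)
    rwa [hdeg] at this
  refine ⟨r.coeff 0, r.coeff 1, r.coeff 2, r.coeff 3, ?_⟩
  rw [← hpr, aeval_eq_sum_range' hrdeg]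
  simp [Finset.sum_range_succ, Kq.ofCoordinates]

lemma even_of_normForm_eq_one {s t u v : ℤ}
    (h : normFormU s t u v ^ 2 + 4 * normFormU s t u v * normFormV s t u v +
      2 * normFormV s t u v ^ 2 = 1) : Even t := by
  by_contra ht
  rw [Int.not_even_iff_odd] at ht
  have hU : Odd (normFormU s t u v) := by
    by_contra hU
    rw [Int.not_odd_iff_even] at hU
    obtain ⟨k, hk⟩ := hU
    rw [hk] at h
    ring_nf at h
    omega
  have hV : Odd (normFormV s t u v) := by
    rw [normFormV]
    obtain ⟨k, rfl⟩ := ht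
    exact ⟨s * u + 2 * u ^ 2 - 2 * k ^ 2 - 2 * k - 1 - 4 * (2 * k + 1) * v - 7 * v ^ 2, by ring⟩
  obtain ⟨k, hk⟩ := hU
  obtain ⟨l, hl⟩ := hV
  rw [hk, hl] at h
  ring_nf at h
  omega

lemma Kq.eq_ofCoordinates_of_coe_eq (x : Kq (2 ^ (1 + 3)))
    (hx : (x : ℝ) = (omegaJReal (2 ^ (1 + 3)) 1 + 2) *
      (omegaJReal (2 ^ (1 + 3)) 1 + omegaJReal (2 ^ (1 + 3)) (2 ^ (1 + 1) - 1) + 3)) :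
    x = Kq.ofCoordinates 4 (-1) 2 2 := by
  set g := Kq.gen (2 ^ (1 + 3)) with hg
  have homega1 : omegaJReal (2 ^ (1 + 3)) 1 = g := by
    rw [omegaJReal, Nat.cast_one, mul_one]; rfl
  have homega3 : omegaJReal (2 ^ (1 + 3)) (2 ^ (1 + 1) - 1) = (g : ℝ) ^ 3 - 3 * g := by
    rw [← homega1, omegaJReal, omegaJReal]
    have h3 : 2 * Real.pi * ((2 ^ (1 + 1) - 1 : ℕ) : ℝ) / ((2 ^ (1 + 3) : ℕ) : ℝ) =
        3 * (2 * Real.pi * ((1 : ℕ) : ℝ) / ((2 ^ (1 + 3) : ℕ) : ℝ)) := by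
      norm_num; ring
    rw [h3, Real.cos_three_mul]
    ring
  have hg4 : g ^ 4 - 4 * g ^ 2 + 2 = 0 := by
    have h := Kq.aeval_gen 2
    rw [cosDoubling_two] at h
    simpa only [map_add, map_sub, map_mul, map_pow, Polynomial.aeval_X, map_ofNat] using h
  have hxg : x = (g + 2) * (g + (g ^ 3 - 3 * g) + 3) := by
    apply Subtype.ext
    rw [hx, homega1, homega3]
    rfl
  rw [hxg, Kq.ofCoordinates]
  push_cast
  linear_combination hg4

lemma not_add_sixteen (β γ : 𝓞 (Kq (2 ^ (1 + 3))))
    (hβ : TotallyPositive _ β) (hγ : TotallyPositive _ γ)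
    (hsum : (β : Kq (2 ^ (1 + 3))) + (γ : Kq (2 ^ (1 + 3))) = Kq.ofCoordinates 4 (-1) 2 2) : False := by
  obtain ⟨s, t, u, v, hc⟩ := Kq.exists_coordinates_sixteen β
  have hc' : (γ : Kq (2 ^ (1 + 3))) = Kq.ofCoordinates (4 - s) (-1 - t) (2 - u) (2 - v) := by
    rw [eq_sub_of_add_eq' hsum, hc]
    simp only [Kq.ofCoordinates]
    push_cast
    ring
  have hdiff : (β - γ : Kq (2 ^ (1 + 3))) =
      Kq.ofCoordinates (2 * (s - 2)) (2 * t + 1) (2 * (u - 1)) (2 * (v - 1)) := by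
    rw [hc, hc']
    simp only [Kq.ofCoordinates]
    push_cast
    ring
  have hprod : ∏ j : Fin (2 ^ (1 + 1)), Kq.embedding 1 j (β + γ : Kq (2 ^ (1 + 3))) =
      2 * (2 ^ 2 ^ (1 + 1) + 1) := by
    rw [hsum, Kq.prod_embedding_sixteen]
    norm_num [normFormU, normFormV]
  obtain ⟨z, w, y, hz, hw, hy, hz0, hw0, hy0, h⟩ :=
    norm_inequality_of_add_eq 1 le_rfl β γ hβ hγ hprod
  rw [hdiff, Kq.prod_embedding_sixteen, Int.cast_inj] at hz
  rw [hc, Kq.prod_embedding_sixteen, Int.cast_inj] at hw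
  rw [hc', Kq.prod_embedding_sixteen, Int.cast_inj] at hy
  have hzeven : Even z := by
    have hU : Even (normFormU (2 * (s - 2)) (2 * t + 1) (2 * (u - 1)) (2 * (v - 1))) :=
      ⟨2 * (s - 2) ^ 2 - 4 * (u - 1) ^ 2 + 4 * (2 * t + 1) * (v - 1) + 16 * (v - 1) ^ 2, by
        rw [normFormU]; ring⟩
    rw [hz]
    simp [Int.even_add, Int.even_pow, hU]
  have hz2 : 4 ≤ z ^ 2 := by
    obtain ⟨k, rfl⟩ := hzeven
    have hk : k ≠ 0 := by rintro rfl; exact hz0 rfl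
    have : 0 < k ^ 2 := by positivity
    nlinarith
  have hwy : 2 ≤ w * y := by
    by_contra! hlt
    have h1 : w * y = 1 := by
      have : 0 < w * y := mul_pos hw0 hy0
      omega
    have hw1 : w = 1 := Int.eq_one_of_mul_eq_one_right hw0.le h1
    have hy1 : y = 1 := by rw [hw1, one_mul] at h1; exact h1
    have ht := even_of_normForm_eq_one (hw.symm.trans hw1)
    have ht' := even_of_normForm_eq_one (hy.symm.trans hy1)
    obtain ⟨k, hk⟩ := ht
    obtain ⟨l, hl⟩ := ht'
    omega
  have hwy4 : 2 ^ 4 ≤ (w * y) ^ 4 := pow_le_pow_left₀ (by norm_num) hwy 4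
  have hmul : 4 * 2 ^ 4 ≤ z ^ 2 * (w * y) ^ 4 := mul_le_mul hz2 hwy4 (by norm_num) (sq_nonneg z)
  norm_num at h hmul
  linarith

/-- For `q = 2^n` with `n > 3`, `d = 2^(n-2)`, `α_n = ω + 2` and `γ_n = ω + ω_{d-1} + 3`,
the product `α_n γ_n` is an indecomposable totally positive integer of `𝓞_{K_{2^n}}`. -/
theorem stmt15 (n : ℕ) (hn : 3 < n) (q d : ℕ) (hq : q = 2 ^ n) (hd : d = 2 ^ (n - 2))
    (δ : 𝓞 ↥(Kq q))
    (hδ : ((δ : ↥(Kq q)) : ℝ) =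
      (omegaJReal q 1 + 2) * (omegaJReal q 1 + omegaJReal q (d - 1) + 3)) :
    TotallyPositive ↥(Kq q) δ ∧ Indecomposable ↥(Kq q) δ := by
  obtain ⟨m, rfl⟩ := Nat.exists_eq_add_of_le' hn.le
  have hm : 1 ≤ m := by omega
  obtain rfl : d = 2 ^ (m + 1) := hd
  subst hq
  have hσ := fun j => Kq.embedding_eq_of_coe_eq m j δ hδ
  refine ⟨fun τ => ?_, ?_⟩
  · obtain ⟨j, hj⟩ := Kq.exists_eq_embedding m τ
    rw [hj, hσ]
    have hsin : Real.sin (oddAngle (m + 1) j) ≠ 0 := sin_oddAngle_ne_zero _ _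
    refine mul_pos ?_ (two_mul_cos_add_pos _)
    have hcos : Real.cos (oddAngle (m + 1) j) ≠ -1 := fun h =>
      hsin (by rw [← sq_eq_zero_iff, Real.sin_sq, h]; norm_num)
    linarith [(Real.neg_one_le_cos (oddAngle (m + 1) j)).lt_of_ne' hcos]
  · rintro ⟨β, γ, hβ, hγ, rfl⟩
    rcases hm.eq_or_lt with rfl | hm2
    · exact not_add_sixteen β γ hβ hγ (Kq.eq_ofCoordinates_of_coe_eq _ hδ)
    · refine not_add_of_two_le m hm2 β γ hβ hγ (Eq.trans ?_ (prod_embedding_eq m hm))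
      exact Finset.prod_congr rfl fun j _ => hσ j
end

section
/- Let q = 2^n with n > 3. Then there is no classical totally positive definite ternary quadratic form that is universal over O_{2^n}. -/
open NumberField

/-- Evaluation `vᵀ M v` of the classical quadratic form with Gram matrix `M`. -/
def evalQF {R : Type*} [CommRing R] {n : ℕ} (M : Matrix (Fin n) (Fin n) R)
    (v : Fin n → R) : R :=
  ∑ i, ∑ j, v i * M i j * v j


/-- A commutative ring together with a distinguished element. -/
structure PointedRing where
  /-- The underlying type. -/
  carrier : Type
  [commRing : CommRing carrier]
  /-- The distinguished element. -/
  gen : carrier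

attribute [instance] PointedRing.commRing

/-- The tower `ℤ ⊂ ℤ[√2] ⊂ ℤ[√(2 + √2)] ⊂ ⋯`, each ring pointed by its nested square root. -/
def cosTower : ℕ → PointedRing
  | 0 => ⟨ℤ, 0⟩
  | k + 1 => ⟨QuadraticAlgebra (cosTower k).carrier (2 + (cosTower k).gen) 0, ⟨0, 1⟩⟩

/-- The ring `ℤ[2 cos (2π / 2 ^ (k + 2))]`, presented as the `k`-th step of `cosTower`. -/
def CosRing (k : ℕ) : Type := (cosTower k).carrier

namespace CosRing

instance (k : ℕ) : CommRing (CosRing k) := (cosTower k).commRing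

/-- The generator `2 cos (2π / 2 ^ (k + 2))`. -/
def gen (k : ℕ) : CosRing k := (cosTower k).gen

/-- The element `2 + 2 cos (2π / 2 ^ (k + 2))`, the square of the next generator. -/
def eps (k : ℕ) : CosRing k := 2 + gen k

/-- The ring at level zero is `ℤ`. -/
def toInt : CosRing 0 ≃+* ℤ := RingEquiv.refl ℤ

variable {k : ℕ}

/-- The element `x + y * gen (k + 1)`. -/
def mk (x y : CosRing k) : CosRing (k + 1) := (⟨x, y⟩ : QuadraticAlgebra _ _ _)

/-- The first coordinate over the previous level. -/
def re (s : CosRing (k + 1)) : CosRing k := QuadraticAlgebra.re s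

/-- The second coordinate over the previous level. -/
def im (s : CosRing (k + 1)) : CosRing k := QuadraticAlgebra.im s

theorem ext {s t : CosRing (k + 1)} (h₁ : re s = re t) (h₂ : im s = im t) : s = t :=
  QuadraticAlgebra.ext h₁ h₂

@[simp] theorem re_mk (x y : CosRing k) : re (mk x y) = x := rfl
@[simp] theorem im_mk (x y : CosRing k) : im (mk x y) = y := rfl
@[simp] theorem re_zero : re (0 : CosRing (k + 1)) = 0 := rfl
@[simp] theorem im_zero : im (0 : CosRing (k + 1)) = 0 := rfl
@[simp] theorem re_one : re (1 : CosRing (k + 1)) = 1 := rfl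
@[simp] theorem im_one : im (1 : CosRing (k + 1)) = 0 := rfl
@[simp] theorem re_gen : re (gen (k + 1)) = 0 := rfl
@[simp] theorem im_gen : im (gen (k + 1)) = 1 := rfl
@[simp] theorem re_add (s t : CosRing (k + 1)) : re (s + t) = re s + re t := rfl
@[simp] theorem im_add (s t : CosRing (k + 1)) : im (s + t) = im s + im t := rfl
@[simp] theorem re_sub (s t : CosRing (k + 1)) : re (s - t) = re s - re t := rfl
@[simp] theorem im_sub (s t : CosRing (k + 1)) : im (s - t) = im s - im t := rfl
@[simp] theorem re_neg (s : CosRing (k + 1)) : re (-s) = -re s := rfl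
@[simp] theorem im_neg (s : CosRing (k + 1)) : im (-s) = -im s := rfl
@[simp] theorem re_intCast (m : ℤ) : re (m : CosRing (k + 1)) = m := rfl
@[simp] theorem im_intCast (m : ℤ) : im (m : CosRing (k + 1)) = 0 := rfl
@[simp] theorem re_ofNat (m : ℕ) [m.AtLeastTwo] :
    re (ofNat(m) : CosRing (k + 1)) = ofNat(m) := rfl
@[simp] theorem im_ofNat (m : ℕ) [m.AtLeastTwo] : im (ofNat(m) : CosRing (k + 1)) = 0 := rfl

@[simp] theorem re_mul (s t : CosRing (k + 1)) :
    re (s * t) = re s * re t + eps k * im s * im t :=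
  QuadraticAlgebra.re_mul s t

@[simp] theorem im_mul (s t : CosRing (k + 1)) :
    im (s * t) = re s * im t + im s * re t :=
  (QuadraticAlgebra.im_mul s t).trans
    (by rw [zero_mul, zero_mul, add_zero]; rfl)

@[simp] theorem toInt_gen : toInt (gen 0) = 0 := rfl
@[simp] theorem toInt_intCast (m : ℤ) : toInt (Int.cast m) = m := map_intCast toInt m
@[simp] theorem toInt_ofNat (m : ℕ) [m.AtLeastTwo] : toInt ofNat(m) = ofNat(m) :=
  map_ofNat toInt m

/-- The inclusion of one level of the tower into the next. -/
def incl (k : ℕ) : CosRing k →+* CosRing (k + 1) where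
  toFun x := mk x 0
  map_zero' := rfl
  map_one' := rfl
  map_add' x y := ext rfl (by simp)
  map_mul' x y := ext (by simp) (by simp)

@[simp] theorem re_incl (x : CosRing k) : re (incl k x) = x := rfl
@[simp] theorem im_incl (x : CosRing k) : im (incl k x) = 0 := rfl

theorem eq_incl_add (s : CosRing (k + 1)) :
    s = incl k (re s) + gen (k + 1) * incl k (im s) :=
  ext (by simp) (by simp)

theorem gen_sq : gen (k + 1) ^ 2 = incl k (eps k) := by
  rw [sq]; exact ext (by simp) (by simp)

/-- The extension of a real embedding determined by a square root of the image of `eps k`. -/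
def extend (φ : CosRing k →+* ℝ) (t : ℝ) (ht : t ^ 2 = φ (eps k)) : CosRing (k + 1) →+* ℝ where
  toFun s := φ (re s) + t * φ (im s)
  map_zero' := by simp
  map_one' := by simp
  map_add' s u := by simp; ring
  map_mul' s u := by simp; linear_combination (-φ (im s) * φ (im u)) * ht

theorem hom_apply (φ : CosRing (k + 1) →+* ℝ) (s : CosRing (k + 1)) :
    φ s = φ.comp (incl k) (re s) + φ (gen (k + 1)) * φ.comp (incl k) (im s) := by
  conv_lhs => rw [eq_incl_add s]
  simp

theorem hom_gen_sq (φ : CosRing (k + 1) →+* ℝ) :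
    φ (gen (k + 1)) ^ 2 = φ.comp (incl k) (eps k) := by
  rw [← map_pow, gen_sq]; rfl

theorem hom_gen_sq_lt (φ : CosRing k →+* ℝ) : φ (gen k) ^ 2 < 4 := by
  induction k with
  | zero =>
    have : gen 0 = 0 := rfl
    simp [this]
  | succ k ih =>
    have h := ih (φ.comp (incl k))
    rw [hom_gen_sq, eps, map_add, map_ofNat]
    nlinarith

theorem hom_eps_pos (φ : CosRing k →+* ℝ) : 0 < φ (eps k) := by
  have h := hom_gen_sq_lt φ
  rw [eps, map_add, map_ofNat]
  nlinarith

/-- The embedding obtained from `extend` with the positive square root. -/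
noncomputable def extendPos (φ : CosRing k →+* ℝ) : CosRing (k + 1) →+* ℝ :=
  extend φ √(φ (eps k)) (Real.sq_sqrt (hom_eps_pos φ).le)

/-- The embedding obtained from `extend` with the negative square root. -/
noncomputable def extendNeg (φ : CosRing k →+* ℝ) : CosRing (k + 1) →+* ℝ :=
  extend φ (-√(φ (eps k))) (by rw [neg_sq]; exact Real.sq_sqrt (hom_eps_pos φ).le)

theorem extendPos_apply (φ : CosRing k →+* ℝ) (s : CosRing (k + 1)) :
    extendPos φ s = φ (re s) + √(φ (eps k)) * φ (im s) := rfl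

theorem extendNeg_apply (φ : CosRing k →+* ℝ) (s : CosRing (k + 1)) :
    extendNeg φ s = φ (re s) - √(φ (eps k)) * φ (im s) := by
  rw [sub_eq_add_neg, ← neg_mul]; rfl

/-- The embedding sending each generator to the positive nested square root. -/
noncomputable def stdHom : (k : ℕ) → CosRing k →+* ℝ
  | 0 => (Int.castRingHom ℝ).comp toInt.toRingHom
  | k + 1 => extendPos (stdHom k)

/-- The normalized trace: the constant coefficient in the iterated presentation. -/
def const : (k : ℕ) → CosRing k →+ ℤ
  | 0 => toInt.toRingHom.toAddMonoidHom
  | k + 1 => { toFun := fun s => const k (re s), map_zero' := by simp, map_add' := by simp }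

@[simp] theorem const_succ (s : CosRing (k + 1)) : const (k + 1) s = const k (re s) := rfl
@[simp] theorem const_zero (s : CosRing 0) : const 0 s = toInt s := rfl

@[simp] theorem const_intCast (m : ℤ) : const k (m : CosRing k) = m := by
  induction k with
  | zero => simp
  | succ k ih => simpa using ih

@[simp] theorem const_ofNat (m : ℕ) [m.AtLeastTwo] :
    const k (ofNat(m) : CosRing k) = ofNat(m) := by
  simpa using const_intCast (k := k) (OfNat.ofNat m)

@[simp] theorem const_one : const k 1 = 1 := by
  simpa using const_intCast (k := k) 1

@[simp] theorem const_gen : const k (gen k) = 0 := by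
  cases k <;> simp

@[simp] theorem const_eps : const k (eps k) = 2 := by
  simp [eps]

theorem const_two_mul (x : CosRing k) : const k (2 * x) = 2 * const k x := by
  rw [two_mul, map_add, two_mul]

theorem const_mul_mod (x y : CosRing k) :
    (const k (x * y) : ZMod 2) = const k x * const k y := by
  induction k with
  | zero => simp
  | succ k ih =>
    have h2 : (2 : ZMod 2) = 0 := rfl
    simp only [const_succ, re_mul, map_add, Int.cast_add, ih, const_eps]
    simp [h2]

theorem even_const_eps_mul (x : CosRing k) : Even (const k (eps k * x)) := by
  rw [← ZMod.intCast_eq_zero_iff_even, const_mul_mod, const_eps]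
  have h2 : (2 : ZMod 2) = 0 := rfl
  simp [h2]

theorem odd_const_mul {x y : CosRing k} (hx : Odd (const k x)) (hy : Odd (const k y)) :
    Odd (const k (x * y)) := by
  rw [← ZMod.intCast_eq_one_iff_odd] at *
  rw [const_mul_mod, hx, hy, one_mul]

theorem even_const_of_mul {x y : CosRing k} (h : Even (const k (x * y))) :
    Even (const k x) ∨ Even (const k y) := by
  by_contra! hc
  simp only [Int.not_even_iff_odd] at hc
  exact Int.not_even_iff_odd.2 (odd_const_mul hc.1 hc.2) h

theorem eq_zero_of_forall_hom {x : CosRing k} (h : ∀ φ : CosRing k →+* ℝ, φ x = 0) : x = 0 := by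
  induction k with
  | zero =>
    have h0 := h (stdHom 0)
    have : ((toInt x : ℤ) : ℝ) = 0 := h0
    exact toInt.injective (by simpa using this)
  | succ k ih =>
    refine ext (ih fun φ ↦ ?_) (ih fun φ ↦ ?_)
    · have h₁ := h (extendPos φ)
      have h₂ := h (extendNeg φ)
      rw [extendPos_apply] at h₁
      rw [extendNeg_apply] at h₂
      linarith
    · have h₁ := h (extendPos φ)
      have h₂ := h (extendNeg φ)
      rw [extendPos_apply] at h₁
      rw [extendNeg_apply] at h₂
      have h₃ : √(φ (eps k)) * φ (im x) = 0 := by linarith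
      exact (mul_eq_zero.1 h₃).resolve_left (Real.sqrt_pos.2 (hom_eps_pos φ)).ne'

theorem eps_mul_cancel {x y : CosRing k} (h : eps k * x = eps k * y) : x = y := by
  refine sub_eq_zero.1 (eq_zero_of_forall_hom fun φ ↦ ?_)
  have h' := congrArg φ h
  rw [map_mul, map_mul] at h'
  rw [map_sub, sub_eq_zero]
  exact mul_left_cancel₀ (hom_eps_pos φ).ne' h'

theorem gen_sq_mul_cancel {x y : CosRing (k + 1)}
    (h : gen (k + 1) ^ 2 * x = gen (k + 1) ^ 2 * y) : x = y := by
  rw [gen_sq] at h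
  have h₁ := congrArg re h
  have h₂ := congrArg im h
  simp only [re_mul, im_mul, re_incl, im_incl, mul_zero, zero_mul, add_zero] at h₁ h₂
  exact ext (eps_mul_cancel h₁) (eps_mul_cancel h₂)

/-- The prime `2` is totally ramified and `eps k` is associated to its conjugate. -/
theorem exists_units (k : ℕ) :
    (∃ v : (CosRing k)ˣ, 2 = v * eps k ^ 2 ^ k) ∧ ∃ u : (CosRing k)ˣ, 2 - gen k = u * eps k := by
  induction k with
  | zero =>
    have h : gen 0 = 0 := rfl
    exact ⟨⟨1, by simp [eps, h]⟩, ⟨1, by simp [eps, h]⟩⟩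
  | succ k ih =>
    obtain ⟨⟨v, hv⟩, ⟨u, hu⟩⟩ := ih
    set ω := gen (k + 1) with hω
    have hωsq : ω ^ 2 = incl k (eps k) := gen_sq
    set v' := Units.map (incl k).toMonoidHom v with hv'
    set u' := Units.map (incl k).toMonoidHom u with hu'
    have hv2 : (2 : CosRing (k + 1)) = v' * ω ^ 2 ^ (k + 1) := by
      have := congrArg (incl k) hv
      rw [map_ofNat, map_mul, map_pow, ← hωsq, ← pow_mul] at this
      rw [pow_succ' 2 k]
      exact this
    have hu2 : 4 - ω ^ 2 = u' * ω ^ 2 := by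
      have := congrArg (incl k) hu
      rw [map_mul, ← hωsq] at this
      rw [show (u' : CosRing (k + 1)) = incl k u from rfl, ← this, hωsq, eps]
      simp only [map_add, map_sub, map_ofNat]
      ring
    obtain ⟨s, hs⟩ : ∃ s, (2 : CosRing (k + 1)) = ω ^ 2 * s := by
      rw [hv2]
      refine ⟨v' * ω ^ (2 ^ (k + 1) - 2), ?_⟩
      have : 2 ^ (k + 1) = 2 + (2 ^ (k + 1) - 2) := by
        have := Nat.one_le_two_pow (n := k)
        rw [pow_succ]; omega
      conv_lhs => rw [this, pow_add]
      ring
    have hprod : (1 + ω * s) * (1 - ω * s) = ((-u' : (CosRing (k + 1))ˣ) : CosRing (k + 1)) := by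
      refine gen_sq_mul_cancel ?_
      rw [Units.val_neg, ← hω]
      linear_combination (2 + ω ^ 2 * s) * hs - hu2
    obtain ⟨a, ha⟩ : IsUnit (1 + ω * s) :=
      isUnit_of_mul_isUnit_left (hprod ▸ Units.isUnit _)
    obtain ⟨b, hb⟩ : IsUnit (1 - ω * s) :=
      isUnit_of_mul_isUnit_right (hprod ▸ Units.isUnit _)
    have hε : eps (k + 1) = ω * a := by
      rw [ha, eps, ← hω]
      linear_combination hs
    refine ⟨⟨v' * a⁻¹ ^ 2 ^ (k + 1), ?_⟩, ⟨-(b * a⁻¹), ?_⟩⟩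
    · rw [hε, mul_pow, hv2]
      push_cast
      have : (↑a⁻¹ : CosRing (k + 1)) ^ 2 ^ (k + 1) * (a : CosRing (k + 1)) ^ 2 ^ (k + 1) = 1 := by
        rw [← mul_pow, Units.inv_mul, one_pow]
      linear_combination (-(v' : CosRing (k + 1)) * ω ^ 2 ^ (k + 1)) * this
    · rw [hε]
      push_cast
      have : (↑a⁻¹ : CosRing (k + 1)) * (a : CosRing (k + 1)) = 1 := Units.inv_mul a
      rw [hb]
      linear_combination hs + (1 - ω * s) * ω * this

theorem eps_dvd_two : eps k ∣ 2 := by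
  obtain ⟨v, hv⟩ := (exists_units k).1
  rw [hv]
  exact Dvd.dvd.mul_left (dvd_pow_self _ (by positivity)) _

theorem two_dvd_eps_pow : (2 : CosRing k) ∣ eps k ^ 2 ^ k := by
  obtain ⟨v, hv⟩ := (exists_units k).1
  have hinv : (↑v⁻¹ : CosRing k) * v = 1 := Units.inv_mul v
  exact ⟨↑v⁻¹, by linear_combination (-(↑v⁻¹ : CosRing k)) * hv - eps k ^ 2 ^ k * hinv⟩

theorem eps_dvd_gen : eps k ∣ gen k := by
  have := dvd_sub (dvd_refl (eps k)) (eps_dvd_two (k := k))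
  rwa [show eps k - 2 = gen k by rw [eps]; ring] at this

theorem eq_intCast_toInt (s : CosRing 0) : s = Int.cast (toInt s) :=
  toInt.injective (by rw [map_intCast, Int.cast_id])

theorem eps_dvd_sub_const (x : CosRing k) : eps k ∣ x - (const k x : CosRing k) := by
  induction k with
  | zero =>
    have h := eq_intCast_toInt x
    rw [const_zero, ← h, sub_self]
    exact dvd_zero _
  | succ k ih =>
    have h₁ := map_dvd (incl k) (ih (re x))
    rw [← gen_sq] at h₁
    have h₂ : x - (const (k + 1) x : CosRing (k + 1)) =
        incl k (re x - (const k (re x) : CosRing k)) + gen (k + 1) * incl k (im x) :=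
      ext (by simp) (by simp)
    rw [h₂]
    exact dvd_add ((eps_dvd_gen.trans (dvd_pow_self _ two_ne_zero)).trans h₁)
      (Dvd.dvd.mul_right eps_dvd_gen _)

theorem eps_dvd_iff {x : CosRing k} : eps k ∣ x ↔ Even (const k x) := by
  constructor
  · rintro ⟨y, rfl⟩
    exact even_const_eps_mul y
  · rintro ⟨m, hm⟩
    have h := eps_dvd_sub_const x
    rw [hm, Int.cast_add, ← two_mul] at h
    exact (dvd_sub_left (Dvd.dvd.mul_right eps_dvd_two _)).1 h

theorem eps_dvd_of_dvd_sq {x : CosRing k} (h : eps k ∣ x ^ 2) : eps k ∣ x := by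
  rw [eps_dvd_iff] at *
  rw [sq] at h
  exact (even_const_of_mul h).elim id id

/-- The form `x ^ 2 - eps k * y ^ 2` is anisotropic at the prime `eps k`. -/
theorem eps_pow_dvd_of_dvd_norm (j : ℕ) {x y : CosRing k}
    (h : eps k ^ (2 * j) ∣ x ^ 2 - eps k * y ^ 2) : eps k ^ j ∣ x ∧ eps k ^ j ∣ y := by
  induction j generalizing x y with
  | zero => simp
  | succ j ih =>
    obtain ⟨z, hz⟩ := h
    obtain ⟨x', rfl⟩ : eps k ∣ x := by
      refine eps_dvd_of_dvd_sq ⟨y ^ 2 + eps k ^ (2 * j + 1) * z, ?_⟩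
      linear_combination hz
    obtain ⟨y', rfl⟩ : eps k ∣ y := by
      refine eps_dvd_of_dvd_sq ⟨x' ^ 2 - eps k ^ (2 * j) * z, eps_mul_cancel ?_⟩
      linear_combination -hz
    have := ih (x := x') (y := y') ⟨z, eps_mul_cancel (eps_mul_cancel (by linear_combination hz))⟩
    rw [pow_succ']
    exact ⟨mul_dvd_mul_left _ this.1, mul_dvd_mul_left _ this.2⟩

theorem eq_zero_of_forall_two_pow_dvd {x : CosRing k}
    (h : ∀ j : ℕ, ((2 ^ j : ℤ) : CosRing k) ∣ x) : x = 0 := by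
  induction k with
  | zero =>
    refine toInt.injective ?_
    rw [map_zero]
    by_contra hx
    have hf : FiniteMultiplicity (2 : ℤ) (toInt x) := Int.finiteMultiplicity_iff.2 ⟨by decide, hx⟩
    refine hf.not_pow_dvd_of_multiplicity_lt (lt_add_one _) ?_
    have h' := map_dvd toInt (h (multiplicity (2 : ℤ) (toInt x) + 1))
    rwa [map_intCast, Int.cast_id] at h'
  | succ k ih =>
    refine ext (ih fun j ↦ ?_) (ih fun j ↦ ?_)
    · obtain ⟨y, hy⟩ := h j
      exact ⟨re y, by rw [hy]; simp only [re_mul, re_intCast, im_intCast]; ring⟩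
    · obtain ⟨y, hy⟩ := h j
      exact ⟨im y, by rw [hy]; simp only [im_mul, re_intCast, im_intCast]; ring⟩

theorem eq_zero_of_sq_eq_eps_mul_sq {x y : CosRing k} (h : x ^ 2 = eps k * y ^ 2) :
    x = 0 ∧ y = 0 := by
  obtain ⟨v, hv⟩ := (exists_units k).1
  have key (j : ℕ) := eps_pow_dvd_of_dvd_norm (2 ^ k * j) (x := x) (y := y)
    (by rw [h, sub_self]; exact dvd_zero _)
  have h2 (j : ℕ) : ((2 ^ j : ℤ) : CosRing k) ∣ eps k ^ (2 ^ k * j) := by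
    rw [pow_mul]
    push_cast
    exact pow_dvd_pow_of_dvd two_dvd_eps_pow j
  exact ⟨eq_zero_of_forall_two_pow_dvd fun j ↦ (h2 j).trans (key j).1,
    eq_zero_of_forall_two_pow_dvd fun j ↦ (h2 j).trans (key j).2⟩

theorem hom_injective (φ : CosRing k →+* ℝ) : Function.Injective φ := by
  rw [injective_iff_map_eq_zero]
  intro s hs
  induction k with
  | zero =>
    rw [eq_intCast_toInt s, map_intCast, Int.cast_eq_zero] at hs
    rw [eq_intCast_toInt s, hs, Int.cast_zero]
  | succ k ih =>
    have h₁ := hom_apply φ s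
    rw [hs] at h₁
    have h₂ := hom_gen_sq φ
    set ψ := φ.comp (incl k)
    have h₃ : re s ^ 2 = eps k * im s ^ 2 := by
      refine sub_eq_zero.1 (ih ψ _ ?_)
      rw [map_sub, map_mul, map_pow, map_pow, ← h₂]
      linear_combination (-ψ (re s) + φ (gen (k + 1)) * ψ (im s)) * h₁
    exact ext (eq_zero_of_sq_eq_eps_mul_sq h₃).1 (eq_zero_of_sq_eq_eps_mul_sq h₃).2

instance : IsDomain (CosRing k) := (hom_injective (stdHom k)).isDomain _

instance : CharZero (CosRing k) :=
  ⟨fun m n h ↦ by simpa using congrArg (stdHom k) h⟩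

theorem isIntegral_hom (φ : CosRing k →+* ℝ) (s : CosRing k) : IsIntegral ℤ (φ s) := by
  induction k with
  | zero =>
    rw [eq_intCast_toInt s, map_intCast]
    exact isIntegral_algebraMap
  | succ k ih =>
    rw [hom_apply]
    refine (ih _ _).add (IsIntegral.mul (IsIntegral.of_pow two_pos ?_) (ih _ _))
    rw [hom_gen_sq]
    exact ih _ _

/-- The ring `CosRing k` is integrally closed: if `s / m` is integral in every real embedding,
then `m` divides `s`. -/
theorem intCast_dvd_of_isIntegral {m : ℤ} (hm : m ≠ 0) {s : CosRing k}
    (h : ∀ φ : CosRing k →+* ℝ, IsIntegral ℤ (φ s / m)) : (m : CosRing k) ∣ s := by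
  induction k generalizing m with
  | zero =>
    have h0 : IsIntegral ℤ (algebraMap ℚ ℝ ((toInt s : ℚ) / m)) := by
      have := h (stdHom 0)
      rw [show stdHom 0 s = ((toInt s : ℤ) : ℝ) from rfl] at this
      simpa using this
    rw [isIntegral_algebraMap_iff (algebraMap ℚ ℝ).injective] at h0
    obtain ⟨z, hz⟩ := IsIntegrallyClosed.isIntegral_iff.1 h0
    refine ⟨toInt.symm z, toInt.injective ?_⟩
    have hm' : (m : ℚ) ≠ 0 := by exact_mod_cast hm
    rw [eq_div_iff hm'] at hz
    have : z * m = toInt s := by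
      have hz' : (z : ℚ) * m = toInt s := hz
      exact_mod_cast hz'
    simp [← this, mul_comm]
  | succ k ih =>
    have hmk : (m : CosRing k) ≠ 0 := by exact_mod_cast hm
    have hp (φ : CosRing k →+* ℝ) := h (extendPos φ)
    have hn (φ : CosRing k →+* ℝ) := h (extendNeg φ)
    simp only [extendPos_apply] at hp
    simp only [extendNeg_apply] at hn
    have hsq (φ : CosRing k →+* ℝ) : √(φ (eps k)) ^ 2 = φ (eps k) :=
      Real.sq_sqrt (hom_eps_pos φ).le
    have hsqrt (φ : CosRing k →+* ℝ) : IsIntegral ℤ √(φ (eps k)) :=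
      IsIntegral.of_pow two_pos (by rw [hsq]; exact isIntegral_hom φ _)
    have hdiff (φ : CosRing k →+* ℝ) : IsIntegral ℤ (2 * √(φ (eps k)) * φ (im s) / m) := by
      have e : 2 * √(φ (eps k)) * φ (im s) / m = (φ (re s) + √(φ (eps k)) * φ (im s)) / m -
          (φ (re s) - √(φ (eps k)) * φ (im s)) / m := by ring
      rw [e]
      exact (hp φ).sub (hn φ)
    obtain ⟨U, hU⟩ : (m : CosRing k) ∣ 2 * re s := ih hm fun φ ↦ by
      have e : φ (2 * re s) / m = (φ (re s) + √(φ (eps k)) * φ (im s)) / m +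
          (φ (re s) - √(φ (eps k)) * φ (im s)) / m := by
        rw [map_mul, map_ofNat]
        ring
      rw [e]
      exact (hp φ).add (hn φ)
    obtain ⟨W, hW⟩ : (m : CosRing k) ∣ eps k * (2 * im s) := ih hm fun φ ↦ by
      have e : φ (eps k * (2 * im s)) / m =
          √(φ (eps k)) * (2 * √(φ (eps k)) * φ (im s) / m) := by
        rw [map_mul, map_mul, map_ofNat]
        linear_combination (-2 * φ (im s) / m) * hsq φ
      rw [e]
      exact (hsqrt φ).mul (hdiff φ)
    have hm2 : m ^ 2 ≠ 0 := pow_ne_zero 2 hm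
    obtain ⟨Z, hZ⟩ : ((m ^ 2 : ℤ) : CosRing k) ∣ eps k * (2 * im s) ^ 2 := ih hm2 fun φ ↦ by
      have e : φ (eps k * (2 * im s) ^ 2) / (m ^ 2 : ℤ) =
          (2 * √(φ (eps k)) * φ (im s) / m) ^ 2 := by
        rw [map_mul, map_pow, map_mul, map_ofNat]
        push_cast
        linear_combination (-4 * φ (im s) ^ 2 / m ^ 2) * hsq φ
      rw [e]
      exact (hdiff φ).pow 2
    obtain ⟨Y, hY⟩ : ((m ^ 2 : ℤ) : CosRing k) ∣ re s ^ 2 - eps k * im s ^ 2 := ih hm2 fun φ ↦ by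
      have e : φ (re s ^ 2 - eps k * im s ^ 2) / (m ^ 2 : ℤ) =
          (φ (re s) + √(φ (eps k)) * φ (im s)) / m *
            ((φ (re s) - √(φ (eps k)) * φ (im s)) / m) := by
        rw [map_sub, map_mul, map_pow, map_pow]
        push_cast
        linear_combination (φ (im s) ^ 2 / m ^ 2) * hsq φ
      rw [e]
      exact (hp φ).mul (hn φ)
    push_cast at hZ hY
    obtain ⟨V, rfl⟩ : eps k ∣ W := by
      refine eps_dvd_of_dvd_sq ⟨Z, mul_left_cancel₀ (pow_ne_zero 2 hmk) ?_⟩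
      linear_combination eps k * hZ - (eps k * (2 * im s) + m * W) * hW
    have hV : 2 * im s = m * V := eps_mul_cancel (by linear_combination hW)
    have hUV : U ^ 2 - eps k * V ^ 2 = 4 * Y := by
      refine mul_left_cancel₀ (pow_ne_zero 2 hmk) ?_
      linear_combination 4 * hY - (2 * re s + m * U) * hU + eps k * (2 * im s + m * V) * hV
    obtain ⟨v, hv⟩ := (exists_units k).1
    have hdvd := eps_pow_dvd_of_dvd_norm (2 ^ k) (x := U) (y := V)
      ⟨v ^ 2 * Y, by
        rw [hUV, pow_mul']
        linear_combination Y * (2 + v * eps k ^ 2 ^ k) * hv⟩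
    obtain ⟨U', rfl⟩ := two_dvd_eps_pow.trans hdvd.1
    obtain ⟨V', rfl⟩ := two_dvd_eps_pow.trans hdvd.2
    refine ⟨mk U' V', ext ?_ ?_⟩
    · simp only [re_mul, re_intCast, im_intCast, re_mk]
      exact mul_left_cancel₀ two_ne_zero (by linear_combination hU)
    · simp only [im_mul, re_intCast, im_intCast, im_mk]
      exact mul_left_cancel₀ two_ne_zero (by linear_combination hV)

/-- Nonnegativity in every real embedding. -/
def NN (x : CosRing k) : Prop := ∀ φ : CosRing k →+* ℝ, 0 ≤ φ x

theorem NN.add {x y : CosRing k} (hx : NN x) (hy : NN y) : NN (x + y) := fun φ ↦ by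
  rw [map_add]
  exact add_nonneg (hx φ) (hy φ)

theorem NN.mul {x y : CosRing k} (hx : NN x) (hy : NN y) : NN (x * y) := fun φ ↦ by
  rw [map_mul]
  exact mul_nonneg (hx φ) (hy φ)

theorem nn_sq (x : CosRing k) : NN (x ^ 2) := fun φ ↦ by
  rw [map_pow]
  exact sq_nonneg _

theorem nn_eps : NN (eps k) := fun φ ↦ (hom_eps_pos φ).le

theorem NN.of_eps_mul {x : CosRing k} (h : NN (eps k * x)) : NN x := fun φ ↦ by
  have h' := h φ
  rw [map_mul] at h'
  exact nonneg_of_mul_nonneg_right h' (hom_eps_pos φ)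

theorem NN.re {s : CosRing (k + 1)} (h : NN s) : NN (re s) := fun φ ↦ by
  have h₁ := h (extendPos φ)
  have h₂ := h (extendNeg φ)
  rw [extendPos_apply] at h₁
  rw [extendNeg_apply] at h₂
  linarith

theorem NN.norm {s : CosRing (k + 1)} (h : NN s) :
    NN (CosRing.re s ^ 2 - eps k * im s ^ 2) := fun φ ↦ by
  have h₁ := mul_nonneg (h (extendPos φ)) (h (extendNeg φ))
  rw [extendPos_apply, extendNeg_apply] at h₁
  have hsq : √(φ (eps k)) ^ 2 = φ (eps k) := Real.sq_sqrt (hom_eps_pos φ).le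
  have e : φ (CosRing.re s ^ 2 - eps k * im s ^ 2) =
      (φ (CosRing.re s) + √(φ (eps k)) * φ (im s)) *
        (φ (CosRing.re s) - √(φ (eps k)) * φ (im s)) := by
    rw [map_sub, map_mul, map_pow, map_pow]
    linear_combination φ (im s) ^ 2 * hsq
  rwa [e]

theorem NN.const_nonneg {x : CosRing k} (h : NN x) : 0 ≤ const k x := by
  induction k with
  | zero =>
    have h0 : (0 : ℝ) ≤ (toInt x : ℤ) := h (stdHom 0)
    exact_mod_cast h0
  | succ k ih => exact ih h.re

theorem eq_zero_of_nn_neg {y : CosRing k} (h : NN (-(eps k * y ^ 2))) : y = 0 := by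
  refine eq_zero_of_forall_hom fun φ ↦ ?_
  have h' := h φ
  rw [map_neg, map_mul, map_pow] at h'
  have := hom_eps_pos φ
  by_contra hy
  have : 0 < φ y ^ 2 := by positivity
  nlinarith

theorem NN.eq_zero {x : CosRing k} (h : NN x) (h0 : const k x = 0) : x = 0 := by
  induction k with
  | zero => exact toInt.injective (by simpa using h0)
  | succ k ih =>
    have hre := ih h.re h0
    have hn := h.norm
    rw [hre, zero_pow two_ne_zero, zero_sub] at hn
    exact ext hre (eq_zero_of_nn_neg hn)

theorem NN.eq {x y : CosRing k} (h : NN (x - y)) (h0 : const k x = const k y) : x = y :=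
  sub_eq_zero.1 (h.eq_zero (by rw [map_sub, h0, sub_self]))

theorem eq_zero_of_const_sq {x : CosRing k} (h : const k (x ^ 2) = 0) : x = 0 :=
  pow_eq_zero_iff two_ne_zero |>.1 ((nn_sq x).eq_zero h)

theorem eps_ne_zero : eps k ≠ 0 := fun h ↦ by
  have := hom_eps_pos (stdHom k)
  rw [h, map_zero] at this
  exact this.false

theorem eq_zero_of_const_eps_mul_sq {x : CosRing k} (h : const k (eps k * x ^ 2) = 0) : x = 0 :=
  pow_eq_zero_iff two_ne_zero |>.1
    ((mul_eq_zero.1 ((nn_eps.mul (nn_sq x)).eq_zero h)).resolve_left eps_ne_zero)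

theorem NN.eq_one {x : CosRing k} (h : NN x) (h1 : const k x = 1) : x = 1 := by
  induction k with
  | zero => exact toInt.injective (by simpa using h1)
  | succ k ih =>
    have hre := ih h.re h1
    have hn := h.norm.const_nonneg
    rw [hre, one_pow, map_sub, const_one] at hn
    have h₁ := (nn_eps.mul (nn_sq (im x))).const_nonneg
    obtain ⟨m, hm⟩ := even_const_eps_mul (im x ^ 2)
    exact ext hre (eq_zero_of_const_eps_mul_sq (by omega))

theorem sq_ne_mk {x y : CosRing k} (hy : Odd (const k y)) (b : CosRing (k + 1)) :
    b ^ 2 ≠ mk x y := fun h ↦ by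
  have h' := congrArg im h
  rw [sq, im_mul, im_mk, mul_comm (im b), ← two_mul] at h'
  rw [← h', const_two_mul] at hy
  exact Int.not_even_iff_odd.2 hy (even_two_mul _)

theorem sq_ne_incl {g : CosRing k} (hg : Odd (const k g)) (h : ∀ b, b ^ 2 ≠ g)
    (b : CosRing (k + 1)) : b ^ 2 ≠ incl k g := fun hb ↦ by
  have h₁ := congrArg re hb
  have h₂ := congrArg im hb
  simp only [sq, re_mul, im_mul, re_incl, im_incl] at h₁ h₂
  have h₃ : re b * im b = 0 := by
    refine (mul_eq_zero.1 (?_ : 2 * (re b * im b) = 0)).resolve_left two_ne_zero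
    linear_combination h₂
  rcases mul_eq_zero.1 h₃ with h₀ | h₀
  · rw [h₀, mul_zero, zero_add, mul_assoc] at h₁
    rw [← h₁] at hg
    exact Int.not_even_iff_odd.2 hg (even_const_eps_mul _)
  · rw [h₀, mul_zero, add_zero, ← sq] at h₁
    exact h _ h₁

/-- The element `3 + √2 + s * √(2 + √2)`. -/
def gam : (k : ℕ) → ℤ → CosRing (k + 2)
  | 0, s => mk (mk 3 1) (mk (Int.cast s) 0)
  | k + 1, s => incl (k + 2) (gam k s)

@[simp] theorem gam_succ (s : ℤ) : gam (k + 1) s = incl (k + 2) (gam k s) := rfl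

@[simp] theorem const_gam (s : ℤ) : const (k + 2) (gam k s) = 3 := by
  induction k with
  | zero => simp [gam]
  | succ k ih => simpa using ih

theorem gen_zero : gen 0 = 0 := rfl

theorem nn_gam {s : ℤ} (hs : s ^ 2 = 1) : NN (gam k s) := by
  induction k with
  | succ k ih => exact fun φ ↦ ih (φ.comp (incl _))
  | zero =>
    intro φ
    have ht := hom_gen_sq φ
    have hw := hom_gen_sq (φ.comp (incl 1))
    have e : gam 0 s = 3 + incl 1 (gen 1) + gen 2 * (s : CosRing 2) := by
      refine ext (ext ?_ ?_) (ext ?_ ?_) <;> simp [gam]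
    rw [e]
    simp only [map_zero, map_ofNat, map_intCast, eps, map_add, map_mul, gen_zero,
      RingHom.comp_apply] at ht hw ⊢
    set w := φ (incl 1 (gen 1))
    set t := φ (gen 2)
    have hs' : (s : ℝ) ^ 2 = 1 := by exact_mod_cast hs
    have h1 : -1.5 ≤ w := by nlinarith
    have h2 : (t * s) ^ 2 ≤ (3 + w) ^ 2 := by
      rw [mul_pow, hs', ht]
      nlinarith
    have := abs_le_of_sq_le_sq h2 (by linarith)
    rw [abs_le] at this
    linarith

theorem not_nn_gam_sub_one {s : ℤ} (hs : s ^ 2 = 1) : ¬ NN (gam 0 s - 1) := fun h ↦ by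
  have := h.norm.norm.const_nonneg
  have hs' : s * s = 1 := by rw [← hs, sq]
  norm_num [gam, sq, eps, hs'] at this

theorem const_of_nn_gam_sub {s : ℤ} (hs : s ^ 2 = 1) {x : CosRing (k + 2)} (hx : NN x)
    (h : NN (gam k s - x)) : const (k + 2) x = 0 ∨ const (k + 2) x = 3 := by
  induction k with
  | succ k ih => exact ih hx.re h.re
  | zero =>
    have h₀ := hx.const_nonneg
    have h₁ := h.const_nonneg
    have h₂ : const (0 + 2) (gam 0 s - x) = 3 - const (0 + 2) x := by rw [map_sub, const_gam]
    by_contra! hc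
    have h₃ : const (0 + 2) x = 1 ∨ const (0 + 2) x = 2 := by omega
    rcases h₃ with h₃ | h₃
    · exact not_nn_gam_sub_one hs (hx.eq_one h₃ ▸ h)
    · have h₄ := h.eq_one (by omega)
      refine not_nn_gam_sub_one hs ?_
      rwa [← h₄, sub_sub_cancel]

theorem odd_const_gam (s : ℤ) : Odd (const (k + 2) (gam k s)) := by
  rw [const_gam]
  decide

theorem sq_ne_gam {s : ℤ} (hs : s ^ 2 = 1) (b : CosRing (k + 2)) : b ^ 2 ≠ gam k s := by
  induction k with
  | zero =>
    refine sq_ne_mk ?_ b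
    rw [const_succ, re_mk, const_intCast]
    exact Int.odd_pow.1 (hs ▸ odd_one) |>.resolve_right two_ne_zero
  | succ k ih => exact sq_ne_incl (odd_const_gam s) ih b

theorem sq_ne_gam_mul_gam (b : CosRing (k + 2)) : b ^ 2 ≠ gam k 1 * gam k (-1) := by
  induction k with
  | zero =>
    have h : gam 0 1 * gam 0 (-1) = incl 1 (mk 9 5) := by
      refine ext (ext ?_ ?_) (ext ?_ ?_) <;> refine toInt.injective ?_ <;> simp [gam, eps]
    rw [h]
    refine sq_ne_incl ?_ (sq_ne_mk ?_) b
    · simp; decide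
    · simp; decide
  | succ k ih =>
    rw [gam_succ, gam_succ, ← map_mul]
    exact sq_ne_incl (odd_const_mul (odd_const_gam _) (odd_const_gam _)) ih b

theorem eq_zero_of_nn_gam_sub_sq {s : ℤ} (hs : s ^ 2 = 1) {a : CosRing (k + 2)}
    (h : NN (gam k s - a ^ 2)) : a = 0 := by
  rcases const_of_nn_gam_sub hs (nn_sq a) h with h₀ | h₀
  · exact eq_zero_of_const_sq h₀
  · exact absurd (h.eq (by rw [h₀, const_gam])).symm (sq_ne_gam hs a)

theorem eq_zero_of_nn_eps_sub_sq {a : CosRing (k + 2)} (h : NN (eps (k + 2) - a ^ 2)) :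
    a = 0 := by
  have hre : re (eps (k + 2) - a ^ 2) = 2 - re a ^ 2 - eps (k + 1) * im a ^ 2 := by
    simp [eps, sq]
    ring
  have him : im (eps (k + 2) - a ^ 2) = 1 - 2 * (re a * im a) := by
    simp [eps, sq]
    ring
  have hn := h.re
  rw [hre] at hn
  have hc := hn.const_nonneg
  rw [map_sub, map_sub, const_ofNat] at hc
  have hx := (nn_sq (re a)).const_nonneg
  have hy := (nn_eps.mul (nn_sq (im a))).const_nonneg
  have him0 : im a = 0 := by
    by_contra hy0
    have hy0' := mt eq_zero_of_const_eps_mul_sq hy0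
    obtain ⟨m, hm⟩ := even_const_eps_mul (im a ^ 2)
    have hx0 : re a = 0 := eq_zero_of_const_sq (by omega)
    have h0 := h.eq_zero (by rw [const_succ, hre, map_sub, map_sub, const_ofNat]; omega)
    rw [h0, hx0] at him
    simp at him
  have hre' : re (eps (k + 2) - a ^ 2) = 2 - re a ^ 2 := by rw [hre, him0]; ring
  refine ext (by_contra fun hx0 ↦ ?_) him0
  rw [re_zero] at hx0
  have hx0' := mt eq_zero_of_const_sq hx0
  have hd := h.re
  have hN := h.norm
  rw [hre'] at hd hN
  rw [him, him0, mul_zero, mul_zero, sub_zero, one_pow, mul_one] at hN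
  have h₁ := (hd.mul (nn_sq (re a))).const_nonneg
  rw [show (2 - re a ^ 2) * re a ^ 2 = 2 * (2 - re a ^ 2) - (2 - re a ^ 2) ^ 2 by ring,
    map_sub, const_two_mul, map_sub, const_ofNat] at h₁
  have h₂ := hN.const_nonneg
  rw [map_sub, const_eps] at h₂
  have h₃ := hN.eq (by rw [const_eps]; omega)
  refine sq_ne_mk (x := 2) (y := 1) (by simp) (2 - re a ^ 2) ?_
  rw [h₃]
  exact ext (by simp [eps]) (by simp [eps])

theorem const_intCast_mul (m : ℤ) (x : CosRing k) : const k (m * x) = m * const k x := by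
  rw [← zsmul_eq_mul, map_zsmul, smul_eq_mul]

/-- An orthogonal system for the trace form scaled by `eps (k + 3)`, given by the quotients
`cos ((2 * j + 1) * θ / 2) / cos (θ / 2)` where `gen (k + 3) = 2 * cos θ`. -/
def orthoSystem (k : ℕ) : Fin 7 → CosRing (k + 3) :=
  ![mk (mk (mk 1 0) (mk 0 0)) (mk (mk 0 0) (mk 0 0)),
    mk (mk (mk (-1) 0) (mk 0 0)) (mk (mk 1 0) (mk 0 0)),
    mk (mk (mk 1 0) (mk 1 0)) (mk (mk (-1) 0) (mk 0 0)),
    mk (mk (mk (-1) 0) (mk (-1) 0)) (mk (mk 0 0) (mk 1 0)),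
    mk (mk (mk 1 1) (mk 1 0)) (mk (mk 0 0) (mk (-1) 0)),
    mk (mk (mk (-1) (-1)) (mk (-1) 0)) (mk (mk 1 1) (mk 0 0)),
    mk (mk (mk 1 1) (mk 0 1)) (mk (mk (-1) (-1)) (mk 0 0))]

theorem odd_const_orthoSystem (i : Fin 7) : Odd (const (k + 3) (orthoSystem k i)) := by
  fin_cases i <;> simp [orthoSystem]

theorem sum_orthoSystem (s : Fin 7 → ℤ) :
    ∑ i, (s i : CosRing (k + 3)) * orthoSystem k i =
      mk (mk (mk (s 0 - s 1 + s 2 - s 3 + s 4 - s 5 + s 6) (s 4 - s 5 + s 6))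
        (mk (s 2 - s 3 + s 4 - s 5) (s 6)))
        (mk (mk (s 1 - s 2 + s 5 - s 6) (s 5 - s 6)) (mk (s 3 - s 4) 0)) := by
  rw [Fin.sum_univ_seven]
  refine ext (ext (ext ?_ ?_) (ext ?_ ?_)) (ext (ext ?_ ?_) (ext ?_ ?_)) <;>
    simp [orthoSystem] <;> ring

theorem const_eps_mul_sum_sq (s : Fin 7 → ℤ) :
    const (k + 3) (eps (k + 3) * (∑ i, (s i : CosRing (k + 3)) * orthoSystem k i) ^ 2) =
      2 * ∑ i, s i ^ 2 := by
  have h : re (re (re (eps (k + 3) * (∑ i, (s i : CosRing (k + 3)) * orthoSystem k i) ^ 2))) =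
      ((2 * ∑ i, s i ^ 2 : ℤ) : CosRing k) +
        ((2 * (s 3 * s 4 + s 2 * s 5 + s 1 * s 6) : ℤ) : CosRing k) * gen k := by
    rw [sum_orthoSystem, Fin.sum_univ_seven]
    push_cast
    simp [sq, eps]
    ring
  rw [const_succ, const_succ, const_succ, h, map_add, const_intCast, const_intCast_mul, const_gen,
    mul_zero, add_zero]

theorem exists_sign {z : ℤ} (hz : Odd z) : ∃ s : ℤ, s ^ 2 = 1 ∧ 1 ≤ s * z := by
  rcases lt_trichotomy z 0 with h | h | h
  · exact ⟨-1, by norm_num, by omega⟩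
  · rw [h] at hz
    exact absurd hz (by decide)
  · exact ⟨1, by norm_num, by omega⟩

/-- Bessel's inequality against `orthoSystem` excludes odd `b`. -/
theorem even_const_of_nn_sub_sq {g b : CosRing (k + 3)} (hg : const (k + 3) g ≤ 3)
    (h : NN (eps (k + 3) * g - b ^ 2)) : Even (const (k + 3) b) := by
  by_contra hb
  rw [Int.not_even_iff_odd] at hb
  choose s hs1 hs2 using fun i ↦ exists_sign (odd_const_mul hb (odd_const_orthoSystem (k := k) i))
  set S := ∑ i, (s i : CosRing (k + 3)) * orthoSystem k i with hS
  have hbS : 7 ≤ const (k + 3) (b * S) := by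
    rw [hS, Finset.mul_sum, map_sum]
    calc (7 : ℤ) = ∑ _i : Fin 7, 1 := by simp
      _ ≤ _ := Finset.sum_le_sum fun i _ ↦ by
        rw [mul_left_comm, const_intCast_mul]
        exact hs2 i
  have hSS := const_eps_mul_sum_sq (k := k) s
  rw [← hS] at hSS
  simp only [hs1, Finset.sum_const, Finset.card_univ, Fintype.card_fin, nsmul_eq_mul, mul_one]
    at hSS
  have hN : NN (((4 : ℤ) : CosRing (k + 3)) * g - ((4 : ℤ) : CosRing (k + 3)) * (b * S) +
      eps (k + 3) * S ^ 2) := by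
    refine NN.of_eps_mul ?_
    have h4 : NN (4 : CosRing (k + 3)) := fun φ ↦ by rw [map_ofNat]; norm_num
    have := (h4.mul h).add (nn_sq (2 * b - eps (k + 3) * S))
    convert this using 1
    push_cast
    ring
  have := hN.const_nonneg
  rw [map_add, map_sub, const_intCast_mul, const_intCast_mul, hSS] at this
  push_cast at this
  omega

set_option maxHeartbeats 1000000 in
theorem even_const_of_nn_gam_zero {s : ℤ} (hs : s ^ 2 = 1) {b : CosRing 2}
    (h : NN (eps 2 * gam 0 s - b ^ 2)) : Even (const 2 b) := by
  by_contra hb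
  rw [Int.not_even_iff_odd] at hb
  have key (t : CosRing 2) : 0 ≤ const 2 (t ^ 2 * (eps 2 * gam 0 s - b ^ 2)) :=
    ((nn_sq t).mul h).const_nonneg
  have hs' : s = 1 ∨ s = -1 := by
    rcases mul_eq_zero.1 (by linear_combination hs : (s - 1) * (s + 1) = 0) with h | h <;> omega
  have k0 := key 1
  have k1 := key (mk (mk (-3) 0) (mk 3 (-1)))
  have k2 := key (mk (mk (-3) (-2)) (mk 0 2))
  have k3 := key (mk (mk (-3) (-3)) (mk (-3) (-3)))
  have k4 := key (mk (mk (-3) (-1)) (mk 3 (-1)))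
  have k5 := key (mk (mk (-3) (-2)) (mk 2 1))
  have k6 := key (mk (mk (-3) 0) (mk (-3) 2))
  simp [gam, sq, eps] at k0 k1 k2 k3 k4 k5 k6 hb
  generalize toInt (re (re b)) = p at *
  generalize toInt (im (re b)) = q at *
  generalize toInt (re (im b)) = r at *
  generalize toInt (im (im b)) = t at *
  obtain ⟨u, rfl⟩ : ∃ u, r = u - t := ⟨r + t, by ring⟩
  have hs1 : s ≤ 1 := by omega
  have k0' : p ^ 2 + 2 * q ^ 2 + 2 * u ^ 2 + 2 * t ^ 2 ≤ 8 := by linarith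
  have hq0 := sq_nonneg q
  have hu0 := sq_nonneg u
  have ht0 := sq_nonneg t
  have hp : p = 1 ∨ p = -1 := by
    have hp3 : p ^ 2 < 3 ^ 2 := by linarith
    have := abs_lt_of_sq_lt_sq hp3 (by norm_num)
    rw [abs_lt] at this
    obtain ⟨m, rfl⟩ := hb
    omega
  have hpp : p ^ 2 = 1 := by rcases hp with rfl | rfl <;> norm_num
  have bound {x : ℤ} (hx : x ^ 2 < 2 ^ 2) : -2 < x ∧ x < 2 :=
    abs_lt.1 (abs_lt_of_sq_lt_sq hx (by norm_num))
  obtain ⟨hq1, hq2⟩ := bound (x := q) (by linarith)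
  obtain ⟨hu1, hu2⟩ := bound (x := u) (by linarith)
  obtain ⟨ht1, ht2⟩ := bound (x := t) (by linarith)
  clear key h hs hs1 k0' hpp hb hq0 hu0 ht0 bound
  rcases hs' with rfl | rfl <;> rcases hp with rfl | rfl <;> interval_cases q <;>
    interval_cases u <;> interval_cases t <;> omega

theorem eq_zero_of_nn_eps_mul_gam_sub_sq {s : ℤ} (hs : s ^ 2 = 1) {b : CosRing (k + 2)}
    (h : NN (eps (k + 2) * gam k s - b ^ 2)) : b = 0 := by
  have hb : Even (const (k + 2) b) := by
    cases k with
    | zero => exact even_const_of_nn_gam_zero hs h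
    | succ k => exact even_const_of_nn_sub_sq (const_gam s).le h
  obtain ⟨c, rfl⟩ := eps_dvd_iff.2 hb
  have hc : NN (gam k s - eps (k + 2) * c ^ 2) := NN.of_eps_mul (by convert h using 1; ring)
  obtain ⟨m, hm⟩ := even_const_eps_mul (c ^ 2)
  rw [eq_zero_of_const_eps_mul_sq ((const_of_nn_gam_sub hs (nn_eps.mul (nn_sq c)) hc).resolve_right
    (by omega)), mul_zero]

theorem not_orthogonal_four {R : Type*} [CommRing R] [IsDomain R]
    {B : LinearMap.BilinForm R (Fin 3 → R)} (hB : ∀ v w, B v w = B w v) {a b c d : Fin 3 → R}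
    (hba : B b a = 0) (hca : B c a = 0) (hda : B d a = 0) (hcb : B c b = 0) (hdb : B d b = 0)
    (hdc : B d c = 0) (ha : B a a ≠ 0) (hb : B b b ≠ 0) (hc : B c c ≠ 0) (hd : B d d ≠ 0) :
    False := by
  set v := ![a, b, c, d] with hv_def
  have hv (i j) (hij : i ≠ j) : B (v i) (v j) = 0 := by
    fin_cases i <;> fin_cases j <;> first
      | exact absurd rfl hij
      | assumption
      | (rw [hB]; assumption)
  have h (i) : B (v i) (v i) ≠ 0 := by
    fin_cases i <;> assumption
  have hli : LinearIndependent R v := by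
    rw [Fintype.linearIndependent_iff]
    intro g hg i
    have := congrArg (fun x ↦ B x (v i)) hg
    simp only [map_sum, map_smul, LinearMap.sum_apply, LinearMap.smul_apply, map_zero,
      LinearMap.zero_apply, smul_eq_mul] at this
    rw [Finset.sum_eq_single i (fun j _ hj ↦ by rw [hv j i hj, mul_zero])
      (fun hi ↦ absurd (Finset.mem_univ i) hi)] at this
    exact (mul_eq_zero.1 this).resolve_right (h i)
  simpa using hli.fintype_card_le_finrank

theorem NN.hom_pos {x : CosRing k} (h : NN x) (hx : x ≠ 0) (φ : CosRing k →+* ℝ) : 0 < φ x :=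
  (h φ).lt_of_ne' ((map_ne_zero_iff φ (hom_injective φ)).2 hx)

theorem gam_ne_zero (s : ℤ) : gam k s ≠ 0 := fun h ↦ by
  have := const_gam (k := k) s
  rw [h, map_zero] at this
  omega

theorem not_exists_universal_ternary :
    ¬ ∃ M : Matrix (Fin 3) (Fin 3) (CosRing (k + 2)), M.IsSymm ∧
        (∀ v : Fin 3 → CosRing (k + 2), v ≠ 0 →
          ∀ φ : CosRing (k + 2) →+* ℝ, 0 < φ (evalQF M v)) ∧
        (∀ α : CosRing (k + 2), (∀ φ : CosRing (k + 2) →+* ℝ, 0 < φ α) →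
          ∃ v : Fin 3 → CosRing (k + 2), evalQF M v = α) := by
  rintro ⟨M, hM, hpos, huniv⟩
  set B := Matrix.toBilin' M with hB
  have hQ (v) : evalQF M v = B v v := (Matrix.toBilin'_apply M v v).symm
  have hsymm (v w) : B v w = B w v := by
    rw [hB, Matrix.toBilin'_apply, Matrix.toBilin'_apply, Finset.sum_comm]
    refine Finset.sum_congr rfl fun i _ ↦ Finset.sum_congr rfl fun j _ ↦ ?_
    rw [hM.apply i j]
    ring
  have hne {v} (hv : v ≠ 0) : B v v ≠ 0 := fun h ↦ by
    have := hpos v hv (stdHom _)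
    rw [hQ, h, map_zero] at this
    exact this.false
  have hnn (v) : NN (B v v) := by
    by_cases hv : v = 0
    · rw [hv, map_zero]
      exact fun φ ↦ (map_zero φ).ge
    · exact fun φ ↦ hQ v ▸ (hpos v hv φ).le
  have hex {α : CosRing (k + 2)} (h : NN α) (h0 : α ≠ 0) : ∃ v, B v v = α := by
    obtain ⟨v, hv⟩ := huniv α (h.hom_pos h0)
    exact ⟨v, hQ v ▸ hv⟩
  have hs1 : (1 : ℤ) ^ 2 = 1 := by norm_num
  have hs2 : (-1 : ℤ) ^ 2 = 1 := by norm_num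
  obtain ⟨e, he⟩ := hex (α := 1) (fun φ ↦ by rw [map_one]; exact zero_le_one) one_ne_zero
  obtain ⟨f, hf⟩ := hex nn_eps eps_ne_zero
  obtain ⟨w, hw⟩ := hex (nn_gam hs1) (gam_ne_zero _)
  obtain ⟨x, hx⟩ := hex (nn_gam hs2) (gam_ne_zero _)
  have orth_e (v) : NN (B v v - B v e ^ 2) := by
    have := hnn (v - B v e • e)
    simp only [map_sub, map_smul, LinearMap.sub_apply, LinearMap.smul_apply, smul_eq_mul, he,
      hsymm e v] at this
    convert this using 1
    ring
  have orth_f (v) : NN (eps (k + 2) * B v v - B v f ^ 2) := by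
    refine NN.of_eps_mul ?_
    have := hnn (eps (k + 2) • v - B v f • f)
    simp only [map_sub, map_smul, LinearMap.sub_apply, LinearMap.smul_apply, smul_eq_mul, hf,
      hsymm f v] at this
    convert this using 1
    ring
  have hfe : B f e = 0 := eq_zero_of_nn_eps_sub_sq (hf ▸ orth_e f)
  have hwe : B w e = 0 := eq_zero_of_nn_gam_sub_sq hs1 (hw ▸ orth_e w)
  have hxe : B x e = 0 := eq_zero_of_nn_gam_sub_sq hs2 (hx ▸ orth_e x)
  have hwf : B w f = 0 := eq_zero_of_nn_eps_mul_gam_sub_sq hs1 (hw ▸ orth_f w)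
  have hxf : B x f = 0 := eq_zero_of_nn_eps_mul_gam_sub_sq hs2 (hx ▸ orth_f x)
  set z := gam k 1 • x - B w x • w with hz
  have hze : B z e = 0 := by simp [hz, hxe, hwe]
  have hzf : B z f = 0 := by simp [hz, hxf, hwf]
  have hzw : B z w = 0 := by simp [hz, hw, hsymm x w, mul_comm]
  have hzx : B z x = gam k 1 * gam k (-1) - B w x ^ 2 := by simp [hz, hx, sq]
  have hz0 : z ≠ 0 := fun h ↦ by
    rw [h, map_zero, LinearMap.zero_apply] at hzx
    exact sq_ne_gam_mul_gam (B w x) (sub_eq_zero.1 hzx.symm).symm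
  exact not_orthogonal_four hsymm hfe hwe hze hwf hzf hzw (he ▸ one_ne_zero) (hf ▸ eps_ne_zero)
    (hw ▸ gam_ne_zero 1) (hne hz0)


theorem stdHom_gen (k : ℕ) : stdHom k (gen k) = 2 * Real.cos (2 * Real.pi / (2 ^ (k + 2) : ℕ)) := by
  induction k with
  | zero =>
    rw [gen_zero, map_zero, show (2 * Real.pi / (2 ^ (0 + 2) : ℕ) : ℝ) = Real.pi / 2 by
      push_cast; ring, Real.cos_pi_div_two, mul_zero]
  | succ k ih =>
    set θ := 2 * Real.pi / (2 ^ (k + 2) : ℕ) with hθ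
    have h2 : (4 : ℝ) ≤ (2 ^ (k + 2) : ℕ) := by
      rw [pow_add]
      push_cast
      linarith [one_le_pow₀ (n := k) (one_le_two (α := ℝ))]
    have hπ := Real.pi_pos
    have hθ0 : 0 ≤ θ := by positivity
    have hθ1 : θ ≤ Real.pi := by
      rw [hθ, div_le_iff₀ (by linarith)]
      nlinarith
    have e : (2 * Real.pi / (2 ^ (k + 1 + 2) : ℕ) : ℝ) = θ / 2 := by
      rw [hθ, pow_add, pow_add, pow_add]
      push_cast
      field_simp
    have h1 : stdHom (k + 1) (gen (k + 1)) = √(stdHom k (eps k)) := by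
      rw [stdHom, extendPos_apply, re_gen, im_gen, map_zero, map_one, zero_add, mul_one]
    have hc : 0 ≤ 2 * Real.cos (θ / 2) := by
      have := Real.cos_nonneg_of_neg_pi_div_two_le_of_le (x := θ / 2) (by linarith) (by linarith)
      linarith
    rw [h1, e, eps, map_add, map_ofNat, ih, ← Real.sqrt_sq hc, mul_pow, Real.cos_sq,
      mul_div_cancel₀ _ (two_ne_zero' ℝ)]
    congr 1
    ring

theorem hom_mem {T : Subring ℝ} (φ : CosRing k →+* ℝ) (h : φ (gen k) ∈ T) (s : CosRing k) :
    φ s ∈ T := by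
  induction k with
  | zero =>
    rw [eq_intCast_toInt s, map_intCast]
    exact intCast_mem T _
  | succ k ih =>
    have hg : φ.comp (incl k) (gen k) ∈ T := by
      have := hom_gen_sq φ
      rw [eps, map_add, map_ofNat] at this
      rw [show φ.comp (incl k) (gen k) = φ (gen (k + 1)) ^ 2 - 2 by linarith]
      exact sub_mem (pow_mem h 2) (ofNat_mem T 2)
    rw [hom_apply]
    exact add_mem (ih _ hg _) (mul_mem h (ih _ hg _))

/-- The embedding of `CosRing k` into the maximal totally real subfield. -/
noncomputable def toField (k : ℕ) : CosRing k →+* Kq (2 ^ (k + 2)) :=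
  (stdHom k).codRestrict (Kq (2 ^ (k + 2))).toSubfield.toSubring fun s ↦
    hom_mem (stdHom k)
      ((stdHom_gen k).symm ▸ IntermediateField.mem_adjoin_simple_self ℚ _) s

theorem coe_toField (s : CosRing k) : (toField k s : ℝ) = stdHom k s := rfl

theorem toField_injective : Function.Injective (toField k) := fun _ _ h ↦
  hom_injective (stdHom k) (congrArg Subtype.val h)

theorem exists_intCast_mul_eq (x : Kq (2 ^ (k + 2))) :
    ∃ m : ℤ, m ≠ 0 ∧ ∃ s : CosRing k, m * x = toField k s := by
  have key : ∀ x ∈ Algebra.adjoin ℚ {stdHom k (gen k)},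
      ∃ m : ℤ, m ≠ 0 ∧ ∃ s : CosRing k, m * x = stdHom k s := by
    intro x hx
    induction hx using Algebra.adjoin_induction with
    | mem x hx =>
      rw [Set.mem_singleton_iff.1 hx]
      exact ⟨1, one_ne_zero, gen k, by simp⟩
    | algebraMap r =>
      refine ⟨r.den, by simp, (r.num : CosRing k), ?_⟩
      rw [map_intCast, eq_ratCast]
      have := Rat.den_mul_eq_num r
      exact_mod_cast this
    | add x y _ _ hx hy =>
      obtain ⟨m, hm, s, hs⟩ := hx
      obtain ⟨n, hn, t, ht⟩ := hy
      refine ⟨m * n, mul_ne_zero hm hn, n * s + m * t, ?_⟩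
      push_cast
      rw [map_add, map_mul, map_mul, map_intCast, map_intCast]
      linear_combination n * hs + m * ht
    | mul x y _ _ hx hy =>
      obtain ⟨m, hm, s, hs⟩ := hx
      obtain ⟨n, hn, t, ht⟩ := hy
      refine ⟨m * n, mul_ne_zero hm hn, s * t, ?_⟩
      push_cast
      rw [map_mul, ← hs, ← ht]
      ring
  have hint : IsAlgebraic ℚ (stdHom k (gen k)) :=
    ((isIntegral_hom (stdHom k) _).tower_top (A := ℚ)).isAlgebraic
  obtain ⟨m, hm, s, hs⟩ := key x (by
    rw [← IntermediateField.adjoin_simple_toSubalgebra_of_isAlgebraic hint, stdHom_gen]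
    exact x.2)
  exact ⟨m, hm, s, Subtype.ext (by simpa [coe_toField] using hs)⟩

theorem exists_lift (φ : CosRing k →+* ℝ) :
    ∃ σ : Kq (2 ^ (k + 2)) →+* ℝ, ∀ s, σ (toField k s) = φ s := by
  let := (toField k).toAlgebra
  have : FaithfulSMul (CosRing k) (Kq (2 ^ (k + 2))) :=
    (faithfulSMul_iff_algebraMap_injective _ _).2 toField_injective
  have : IsFractionRing (CosRing k) (Kq (2 ^ (k + 2))) := by
    refine IsFractionRing.of_field _ _ fun x ↦ ?_
    obtain ⟨m, hm, s, hs⟩ := exists_intCast_mul_eq x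
    refine ⟨s, m, ?_⟩
    have hm' : (m : Kq (2 ^ (k + 2))) ≠ 0 := by exact_mod_cast hm
    rw [map_intCast, eq_div_iff hm', mul_comm, hs]
    rfl
  exact ⟨IsFractionRing.lift (hom_injective φ), IsFractionRing.lift_algebraMap _⟩

theorem isIntegral_toField (s : CosRing k) : IsIntegral ℤ (toField k s) :=
  (isIntegral_algHom_iff (algebraMap (Kq (2 ^ (k + 2))) ℝ).toIntAlgHom Subtype.val_injective).1
    (isIntegral_hom (stdHom k) s)

/-- The map from `CosRing k` to the ring of integers of the maximal totally real subfield. -/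
noncomputable def toRingOfIntegers (k : ℕ) : CosRing k →+* 𝓞 (Kq (2 ^ (k + 2))) :=
  (toField k).codRestrict (integralClosure ℤ (Kq (2 ^ (k + 2)))) isIntegral_toField

theorem toRingOfIntegers_bijective : Function.Bijective (toRingOfIntegers k) := by
  refine ⟨fun s t h ↦ toField_injective (congrArg Subtype.val h), fun x ↦ ?_⟩
  obtain ⟨m, hm, s, hs⟩ := exists_intCast_mul_eq (x : Kq (2 ^ (k + 2)))
  obtain ⟨t, rfl⟩ := intCast_dvd_of_isIntegral hm (s := s) fun φ ↦ by
    obtain ⟨σ, hσ⟩ := exists_lift φ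
    have hm' : (m : ℝ) ≠ 0 := by exact_mod_cast hm
    rw [← hσ, ← hs, map_mul, map_intCast, mul_div_cancel_left₀ _ hm']
    exact (RingOfIntegers.isIntegral_coe x).map (σ.toIntAlgHom)
  have hm' : (m : Kq (2 ^ (k + 2))) ≠ 0 := by exact_mod_cast hm
  rw [map_mul, map_intCast] at hs
  exact ⟨t, RingOfIntegers.ext (mul_left_cancel₀ hm' hs).symm⟩

/-- The ring of integers of the maximal totally real subfield is `CosRing k`. -/
noncomputable def equivRingOfIntegers (k : ℕ) : CosRing k ≃+* 𝓞 (Kq (2 ^ (k + 2))) :=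
  RingEquiv.ofBijective (toRingOfIntegers k) toRingOfIntegers_bijective

theorem totallyPositive_iff (s : CosRing k) :
    TotallyPositive (Kq (2 ^ (k + 2))) (equivRingOfIntegers k s) ↔
      ∀ φ : CosRing k →+* ℝ, 0 < φ s := by
  refine ⟨fun h φ ↦ ?_, fun h σ ↦ h (σ.comp (toField k))⟩
  obtain ⟨σ, hσ⟩ := exists_lift φ
  exact hσ s ▸ h σ

end CosRing

theorem map_evalQF {R S : Type*} [CommRing R] [CommRing S] {n : ℕ} (f : R →+* S)
    (M : Matrix (Fin n) (Fin n) R) (v : Fin n → R) :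
    f (evalQF M v) = evalQF (M.map f) (f ∘ v) := by
  simp [evalQF]

/-- For `q = 2^n` with `n > 3`, there is no classical totally positive definite ternary
quadratic form that is universal over `𝓞_{K_{2^n}}`. -/
theorem stmt16 (n : ℕ) (hn : 3 < n) (q : ℕ) (hq : q = 2 ^ n) :
    ¬ ∃ M : Matrix (Fin 3) (Fin 3) (𝓞 ↥(Kq q)), M.IsSymm ∧
        (∀ v : Fin 3 → 𝓞 ↥(Kq q), v ≠ 0 → TotallyPositive ↥(Kq q) (evalQF M v)) ∧
        (∀ α : 𝓞 ↥(Kq q), TotallyPositive ↥(Kq q) α →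
          ∃ v : Fin 3 → 𝓞 ↥(Kq q), evalQF M v = α) := by
  obtain ⟨k, rfl⟩ : ∃ k, n = k + 2 + 2 := ⟨n - 4, by omega⟩
  subst hq
  rintro ⟨M, hM, hpos, huniv⟩
  set e := CosRing.equivRingOfIntegers (k + 2) with he
  have heval (v : Fin 3 → CosRing (k + 2)) :
      e (evalQF (M.map e.symm) v) = evalQF M (e ∘ v) := by
    have := map_evalQF e.toRingHom (M.map e.symm) v
    simpa [Matrix.map_map, Function.comp_def] using this
  refine CosRing.not_exists_universal_ternary (k := k) ⟨M.map e.symm, hM.map _, fun v hv ↦ ?_,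
    fun α hα ↦ ?_⟩
  · rw [← CosRing.totallyPositive_iff, ← he, heval]
    refine hpos _ fun h ↦ hv (funext fun i ↦ e.injective ?_)
    rw [Pi.zero_apply, map_zero]
    exact congrFun h i
  · obtain ⟨v, hv⟩ := huniv (e α) ((CosRing.totallyPositive_iff α).2 hα)
    refine ⟨e.symm ∘ v, e.injective ?_⟩
    rw [heval, ← hv]
    congr 1
    ext i
    simp
end

section
/- Let p ≥ 29 be a prime, let d = (p−1)/2, and suppose β ∈ O_p satisfies Tr_{K_p/ℚ}(β²) < 4d + 2. Then β or −β equals one of the following (for some i, h ∈ {1, …, d} with i ≠ h): 0, 1, ω_i, ω_i + 1, ω_i − 1, ω_i + ω_h, or 2; and the corresponding values of Tr_{K_p/ℚ}(β²) are 0, d, 2d−1, 3d−3, 3d+1, 4d−6, and 4d, respectively. -/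
open NumberField

section Combinatorics

open Finset

lemma exists_unit_of_sum_sq_le_two {s : Finset ℕ} {c : ℕ → ℤ} (h0 : 0 < ∑ i ∈ s, c i ^ 2)
    (h2 : ∑ i ∈ s, c i ^ 2 ≤ 2) : ∃ i ∈ s, c i = 1 ∨ c i = -1 := by
  obtain ⟨i, hi, hne⟩ := exists_ne_zero_of_sum_ne_zero h0.ne'
  have hle : c i ^ 2 ≤ ∑ i ∈ s, c i ^ 2 :=
    single_le_sum (f := fun i => c i ^ 2) (fun j _ => sq_nonneg (c j)) hi
  have h1 : c i ≤ 1 := by nlinarith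
  have h3 : -1 ≤ c i := by nlinarith
  have h4 : c i ≠ 0 := by rintro h; simp [h] at hne
  exact ⟨i, hi, by omega⟩

lemma eq_zero_of_sum_sq_eq_zero {s : Finset ℕ} {c : ℕ → ℤ} (h : ∑ i ∈ s, c i ^ 2 = 0) :
    ∀ i ∈ s, c i = 0 := fun i hi => by
  simpa using (sum_eq_zero_iff_of_nonneg (fun j _ => sq_nonneg (c j))).1 h i hi

lemma sum_sq_le_four {p S Q : ℤ} (hp : 29 ≤ p) (hS : |S| ≤ Q) (hS2 : 2 * |S| ≤ p)
    (h : p * Q - S ^ 2 < 4 * p) : Q ≤ 4 := by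
  rw [← sq_abs] at h
  have hs := abs_nonneg S
  generalize |S| = s at *
  have hQ : Q ≤ 7 := by
    by_contra! hQ
    nlinarith
  by_contra! h4
  interval_cases Q <;> nlinarith

lemma abs_le_sq (x : ℤ) : |x| ≤ x ^ 2 := by
  rw [← sq_abs]
  rcases (abs_nonneg x).eq_or_lt with h | h
  · simp [← h]
  · nlinarith

lemma exists_two_mul_abs_add_mul_le (p : ℕ) (hp : 0 < p) (S : ℤ) : ∃ m : ℤ, 2 * |S + p * m| ≤ p := by
  refine ⟨-S.bdiv p, ?_⟩
  have h1 := Int.bmod_add_bdiv S p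
  have h2 := Int.bmod_lt (x := S) hp
  have h3 := Int.le_bmod (x := S) hp
  have : S + p * -S.bdiv p = S.bmod p := by linarith
  rw [this]
  have := abs_le.2 ⟨(by omega : -((p : ℤ) / 2) ≤ S.bmod p), (by omega : S.bmod p ≤ (p : ℤ) / 2)⟩
  omega

/-- The vectors `(c₀, c₁, c₁, …, c_d, c_d)` with sum `S`, `2 |S| ≤ 2d + 1` and
`(2d + 1) ∑ cᵢ² - S² < 8d + 4` have at most two nonzero coordinates, listed here. -/
lemma eq_short_combination_of_lt (d : ℕ) (hd : 14 ≤ d) (c : ℕ → ℤ) (w : ℕ → ℝ) (b : ℝ) (t : ℚ)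
    (hb : b = c 0 + ∑ i ∈ Icc 1 d, c i * w i)
    (ht : 2 * t = (2 * d + 1) * ((c 0 ^ 2 + 2 * ∑ i ∈ Icc 1 d, c i ^ 2 : ℤ) : ℚ) -
      ((c 0 + 2 * ∑ i ∈ Icc 1 d, c i : ℤ) : ℚ) ^ 2)
    (hS : 2 * |c 0 + 2 * ∑ i ∈ Icc 1 d, c i| ≤ 2 * d + 1)
    (hlt : t < 4 * d + 2) :
    (b = 0 ∧ t = 0) ∨
    ((b = 1 ∨ b = -1) ∧ t = d) ∨
    ((∃ i : ℕ, 1 ≤ i ∧ i ≤ d ∧ (b = w i ∨ b = -w i)) ∧ t = 2 * d - 1) ∨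
    ((∃ i : ℕ, 1 ≤ i ∧ i ≤ d ∧ (b = w i + 1 ∨ b = -(w i + 1))) ∧ t = 3 * d - 3) ∨
    ((∃ i : ℕ, 1 ≤ i ∧ i ≤ d ∧ (b = w i - 1 ∨ b = -(w i - 1))) ∧ t = 3 * d + 1) ∨
    ((∃ i h : ℕ, 1 ≤ i ∧ i ≤ d ∧ 1 ≤ h ∧ h ≤ d ∧ i ≠ h ∧
        (b = w i + w h ∨ b = -(w i + w h))) ∧ t = 4 * d - 6) ∨
    ((b = 2 ∨ b = -2) ∧ t = 4 * d) := by
  have hQ : c 0 ^ 2 + 2 * ∑ i ∈ Icc 1 d, c i ^ 2 ≤ 4 := by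
    refine sum_sq_le_four (p := 2 * d + 1) (by omega) ?_ hS ?_
    · have habs : |∑ i ∈ Icc 1 d, c i| ≤ ∑ i ∈ Icc 1 d, c i ^ 2 :=
        (abs_sum_le_sum_abs _ _).trans (sum_le_sum fun i _ => abs_le_sq (c i))
      have h0 := abs_le_sq (c 0)
      refine (abs_add_le _ _).trans ?_
      rw [abs_mul, abs_two]
      linarith
    · have : (2 * (t : ℚ)) < 4 * (2 * d + 1) := by linarith
      rw [ht] at this
      exact_mod_cast this
  have hq0 : 0 ≤ ∑ i ∈ Icc 1 d, c i ^ 2 := sum_nonneg fun i _ => sq_nonneg (c i)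
  have hc0 := sq_nonneg (c 0)
  have hcu : c 0 ≤ 2 := by nlinarith
  have hcl : -2 ≤ c 0 := by nlinarith
  rcases hq0.eq_or_lt with hq | hq
  · have hz := eq_zero_of_sum_sq_eq_zero hq.symm
    rw [sum_eq_zero fun i hi => by rw [hz i hi]; simp] at hb
    rw [← hq, sum_eq_zero hz] at ht
    have : c 0 = 0 ∨ c 0 = 1 ∨ c 0 = -1 ∨ c 0 = 2 ∨ c 0 = -2 := by omega
    rcases this with h | h | h | h | h <;> rw [h] at hb ht <;> norm_num at hb ht
    · exact Or.inl ⟨hb, ht⟩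
    · exact Or.inr <| Or.inl ⟨Or.inl hb, by linarith⟩
    · exact Or.inr <| Or.inl ⟨Or.inr hb, by linarith⟩
    · iterate 6 right
      exact ⟨Or.inl hb, by linarith⟩
    · iterate 6 right
      exact ⟨Or.inr hb, by linarith⟩
  · obtain ⟨i, hi, hci⟩ := exists_unit_of_sum_sq_le_two hq (by linarith)
    have hi' := mem_Icc.1 hi
    rw [← add_sum_erase _ _ hi] at hb hQ
    simp only [← add_sum_erase _ _ hi] at ht
    have hci2 : c i ^ 2 = 1 := by rcases hci with h | h <;> simp [h]
    have hr0 : 0 ≤ ∑ j ∈ (Icc 1 d).erase i, c j ^ 2 := sum_nonneg fun j _ => sq_nonneg (c j)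
    rcases hr0.eq_or_lt with hr | hr
    · have hz := eq_zero_of_sum_sq_eq_zero hr.symm
      rw [sum_eq_zero fun j hj => by rw [hz j hj]; simp] at hb
      rw [← hr, sum_eq_zero hz] at ht
      have h1 : c 0 ≤ 1 := by nlinarith
      have h2 : -1 ≤ c 0 := by nlinarith
      have : c 0 = 0 ∨ c 0 = 1 ∨ c 0 = -1 := by omega
      rcases this with h | h | h <;> rcases hci with h' | h' <;> rw [h, h'] at hb ht <;>
        norm_num at hb ht
      · exact Or.inr <| Or.inr <| Or.inl ⟨⟨i, hi'.1, hi'.2, Or.inl hb⟩, by linarith⟩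
      · exact Or.inr <| Or.inr <| Or.inl ⟨⟨i, hi'.1, hi'.2, Or.inr hb⟩, by linarith⟩
      · exact Or.inr <| Or.inr <| Or.inr <| Or.inl
          ⟨⟨i, hi'.1, hi'.2, Or.inl (by linarith)⟩, by linarith⟩
      · exact Or.inr <| Or.inr <| Or.inr <| Or.inr <| Or.inl
          ⟨⟨i, hi'.1, hi'.2, Or.inr (by linarith)⟩, by linarith⟩
      · exact Or.inr <| Or.inr <| Or.inr <| Or.inr <| Or.inl
          ⟨⟨i, hi'.1, hi'.2, Or.inl (by linarith)⟩, by linarith⟩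
      · exact Or.inr <| Or.inr <| Or.inr <| Or.inl
          ⟨⟨i, hi'.1, hi'.2, Or.inr (by linarith)⟩, by linarith⟩
    · obtain ⟨j, hj, hcj⟩ := exists_unit_of_sum_sq_le_two hr (by linarith)
      have hj' := mem_Icc.1 (mem_of_mem_erase hj)
      have hij : i ≠ j := (ne_of_mem_erase hj).symm
      rw [← add_sum_erase _ _ hj] at hb hQ
      simp only [← add_sum_erase _ _ hj] at ht
      have hcj2 : c j ^ 2 = 1 := by rcases hcj with h | h <;> simp [h]
      have hz : ∑ k ∈ ((Icc 1 d).erase i).erase j, c k ^ 2 = 0 :=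
        le_antisymm (by linarith) (sum_nonneg fun k _ => sq_nonneg (c k))
      have h0 : c 0 = 0 := by
        have : c 0 ^ 2 = 0 := by linarith
        simpa using this
      rw [sum_eq_zero fun k hk => by rw [eq_zero_of_sum_sq_eq_zero hz k hk]; simp] at hb
      rw [hz, sum_eq_zero (eq_zero_of_sum_sq_eq_zero hz)] at ht
      rcases hci with h' | h' <;> rcases hcj with h | h <;> rw [h, h', h0] at hb ht <;>
        norm_num at hb ht
      · iterate 5 right
        exact Or.inl ⟨⟨i, j, hi'.1, hi'.2, hj'.1, hj'.2, hij, Or.inl hb⟩, by linarith⟩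
      · linarith
      · linarith
      · iterate 5 right
        exact Or.inl ⟨⟨i, j, hi'.1, hi'.2, hj'.1, hj'.2, hij, Or.inr (by linarith)⟩, by linarith⟩

end Combinatorics

section Cyclotomic

variable {p : ℕ} [Fact p.Prime] {L : Type*} [Field L] {ζ : L}

lemma sum_zmodChar_eq_zero (hζ : IsPrimitiveRoot ζ p) :
    ∑ j, AddChar.zmodChar p hζ.pow_eq_one j = 0 := by
  refine AddChar.sum_eq_zero_of_ne_one fun h => ?_
  have h1 := AddChar.zmodChar_apply' hζ.pow_eq_one 1
  rw [h, AddChar.one_apply, pow_one] at h1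
  exact hζ.ne_one (Fact.out : p.Prime).one_lt h1.symm

variable [CharZero L] [IsCyclotomicExtension {p} ℚ L]

lemma trace_zmodChar (hζ : IsPrimitiveRoot ζ p) (j : ZMod p) :
    Algebra.trace ℚ L (AddChar.zmodChar p hζ.pow_eq_one j) = (if j = 0 then (p : ℚ) else 0) - 1 := by
  have hp : p.Prime := Fact.out
  split_ifs with h
  · rw [h, AddChar.map_zero_eq_one, ← map_one (algebraMap ℚ L), Algebra.trace_algebraMap,
      IsCyclotomicExtension.finrank (n := p) L (Polynomial.cyclotomic.irreducible_rat hp.pos),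
      Nat.totient_prime hp]
    simp [Nat.cast_pred hp.pos]
  · rw [AddChar.zmodChar_apply]
    have hcop : j.val.Coprime p := by
      have := ZMod.val_coe_unit_coprime (Units.mk0 j h)
      simpa using this
    have hμ : IsPrimitiveRoot (ζ ^ j.val) p := hζ.pow_of_coprime _ hcop
    have := (hμ.powerBasis ℚ).trace_gen_eq_nextCoeff_minpoly
    rw [IsPrimitiveRoot.powerBasis_gen, ← Polynomial.cyclotomic_eq_minpoly_rat hμ hp.pos] at this
    rw [this]
    have hd : (Polynomial.cyclotomic p ℚ).natDegree = p - 1 := by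
      rw [Polynomial.natDegree_cyclotomic, Nat.totient_prime hp]
    have h2 := hp.two_le
    rw [Polynomial.nextCoeff_of_natDegree_pos (by omega), hd, Polynomial.cyclotomic_prime,
      Polynomial.finsetSum_coeff]
    simp only [Polynomial.coeff_X_pow]
    rw [Finset.sum_ite_eq]
    simp [show p - 1 - 1 < p by omega]

lemma exists_eq_sum_zmodChar (hζ : IsPrimitiveRoot ζ p) {x : L} (hx : IsIntegral ℤ x) :
    ∃ a : ZMod p → ℤ, x = ∑ j, (a j : L) * AddChar.zmodChar p hζ.pow_eq_one j := by
  have := IsCyclotomicExtension.Rat.isIntegralClosure_adjoin_singleton_of_prime hζ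
  obtain ⟨⟨y, hmem⟩, rfl⟩ :=
    (IsIntegralClosure.isIntegral_iff (A := Algebra.adjoin ℤ {ζ})).1 hx
  change ∃ a : ZMod p → ℤ, y = _
  have hy : y ∈ Submodule.span ℤ (Submonoid.closure {ζ} : Set L) := by
    rwa [← Algebra.adjoin_eq_span]
  clear hmem hx
  induction hy using Submodule.span_induction with
  | mem y hy =>
    obtain ⟨n, rfl⟩ := Submonoid.mem_closure_singleton.1 hy
    refine ⟨Pi.single (n : ZMod p) 1, ?_⟩
    rw [Finset.sum_eq_single (n : ZMod p)]
    · simp [AddChar.zmodChar_apply']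
    · intro b _ hb
      simp [hb]
    · simp
  | zero => exact ⟨0, by simp⟩
  | add y z _ _ hy hz =>
    obtain ⟨a, rfl⟩ := hy
    obtain ⟨b, rfl⟩ := hz
    exact ⟨a + b, by simp [add_mul, Finset.sum_add_distrib]⟩
  | smul n y _ hy =>
    obtain ⟨a, rfl⟩ := hy
    exact ⟨n • a, by simp [Finset.mul_sum, mul_assoc]⟩

lemma trace_intCast_mul (n : ℤ) (x : L) :
    Algebra.trace ℚ L (n * x) = n * Algebra.trace ℚ L x := by
  rw [← zsmul_eq_mul, map_zsmul, zsmul_eq_mul]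

lemma trace_sum_mul_zmodChar (hζ : IsPrimitiveRoot ζ p) (a : ZMod p → ℤ) (k : ZMod p) :
    Algebra.trace ℚ L ((∑ j, (a j : L) * AddChar.zmodChar p hζ.pow_eq_one j) *
      AddChar.zmodChar p hζ.pow_eq_one k) = p * a (-k) - ∑ j, (a j : ℚ) := by
  simp only [Finset.sum_mul, map_sum, mul_assoc, ← AddChar.map_add_eq_mul, trace_intCast_mul,
    trace_zmodChar hζ, mul_sub, mul_one, Finset.sum_sub_distrib, mul_ite, mul_zero,
    add_eq_zero_iff_eq_neg]
  simp [mul_comm]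

lemma eq_of_sum_zmodChar_eq_zero (hζ : IsPrimitiveRoot ζ p) {a : ZMod p → ℤ}
    (h : ∑ j, (a j : L) * AddChar.zmodChar p hζ.pow_eq_one j = 0) (i j : ZMod p) : a i = a j := by
  have hp : (p : ℚ) ≠ 0 := by exact_mod_cast (Fact.out : p.Prime).ne_zero
  have hk (k : ZMod p) : (p : ℚ) * a k = ∑ j, (a j : ℚ) := by
    have := trace_sum_mul_zmodChar hζ a (-k)
    rw [h, zero_mul, map_zero, neg_neg] at this
    linarith
  exact_mod_cast mul_left_cancel₀ hp ((hk i).trans (hk j).symm)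

lemma trace_sq_sum_zmodChar (hζ : IsPrimitiveRoot ζ p) {a : ZMod p → ℤ}
    (ha : ∀ j, a (-j) = a j) :
    Algebra.trace ℚ L ((∑ j, (a j : L) * AddChar.zmodChar p hζ.pow_eq_one j) ^ 2) =
      p * ((∑ j, a j ^ 2 : ℤ) : ℚ) - ((∑ j, a j : ℤ) : ℚ) ^ 2 := by
  conv_lhs => rw [sq]; enter [2]; rw [Finset.mul_sum]
  simp only [mul_left_comm _ (Int.cast _), map_sum, trace_intCast_mul,
    trace_sum_mul_zmodChar hζ, ha]
  push_cast
  simp only [mul_sub, Finset.sum_sub_distrib]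
  rw [sq (∑ j, (a j : ℚ)), Finset.sum_mul Finset.univ (fun j => (a j : ℚ)) (∑ j, (a j : ℚ))]
  congr 1
  rw [Finset.mul_sum]
  exact Finset.sum_congr rfl fun j _ => by ring

end Cyclotomic

open Finset in
lemma ZMod.sum_eq_zero_add_sum_Icc {p d : ℕ} [NeZero p] (hp : p = 2 * d + 1) {M : Type*}
    [AddCommMonoid M] (f : ZMod p → M) :
    ∑ j, f j = f 0 + ∑ i ∈ Icc 1 d, (f i + f (-i)) := by
  have h1 : ∑ j, f j = ∑ i ∈ range p, f i := by
    refine Finset.sum_bij' (fun j _ => j.val) (fun i _ => (i : ZMod p)) ?_ ?_ ?_ ?_ ?_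
    · exact fun j _ => mem_range.2 j.val_lt
    · simp
    · simp
    · exact fun i hi => ZMod.val_cast_of_lt (mem_range.1 hi)
    · simp
  have h2 : ∑ i ∈ Icc 1 d, f (-i) = ∑ i ∈ Icc (d + 1) (2 * d), f i := by
    refine Finset.sum_bij' (fun i _ => p - i) (fun i _ => p - i) ?_ ?_ ?_ ?_ ?_
    · intro i hi
      simp only [mem_Icc] at hi ⊢
      omega
    · intro i hi
      simp only [mem_Icc] at hi ⊢
      omega
    · intro i hi
      simp only [mem_Icc] at hi
      omega
    · intro i hi
      simp only [mem_Icc] at hi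
      omega
    · intro i hi
      simp only [mem_Icc] at hi
      rw [Nat.cast_sub (by omega)]
      simp
  rw [h1, sum_add_distrib, h2, show range p = range (2 * d + 1) by rw [hp],
    Finset.sum_range_succ', add_comm]
  congr 1
  · simp
  · rw [← Finset.sum_union]
    · rw [Finset.range_eq_Ico, Finset.sum_Ico_add' (fun i : ℕ => f (i : ZMod _)) 0 (2 * d) 1]
      refine Finset.sum_congr ?_ fun _ _ => rfl
      ext i
      simp only [mem_Ico, mem_union, mem_Icc]
      omega
    · rw [Finset.disjoint_left]
      intro i hi hi'
      simp only [mem_Icc] at hi hi'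
      omega

section RealSubfield

open IntermediateField Polynomial Finset

variable {p : ℕ} {ζ : ℂ}

lemma two_cos_eq_exp_add_exp (x : ℝ) :
    ((2 * Real.cos x : ℝ) : ℂ) = Complex.exp (x * Complex.I) + (Complex.exp (x * Complex.I))⁻¹ := by
  push_cast
  rw [Complex.two_cos, ← Complex.exp_neg, neg_mul]

lemma omegaJReal_eq (hζ : ζ = Complex.exp (2 * Real.pi * Complex.I / p)) (j : ℕ) :
    (omegaJReal p j : ℂ) = ζ ^ j + (ζ ^ j)⁻¹ := by
  rw [omegaJReal, two_cos_eq_exp_add_exp, hζ, ← Complex.exp_nat_mul]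
  have h : ((2 * Real.pi * j / p : ℝ) : ℂ) * Complex.I = j * (2 * Real.pi * Complex.I / p) := by
    push_cast
    ring
  rw [h]

lemma ofReal_mem_of_mem_Kq (hζ : ζ = Complex.exp (2 * Real.pi * Complex.I / p)) {x : ℝ}
    (hx : x ∈ Kq p) : (x : ℂ) ∈ ℚ⟮ζ⟯ := by
  have hle : Kq p ≤ ℚ⟮ζ⟯.comap (Complex.ofRealAm.restrictScalars ℚ) := by
    rw [Kq, adjoin_le_iff, Set.singleton_subset_iff]
    change ((2 * Real.cos (2 * Real.pi / p) : ℝ) : ℂ) ∈ ℚ⟮ζ⟯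
    have h := omegaJReal_eq hζ 1
    rw [omegaJReal, Nat.cast_one, mul_one, pow_one] at h
    rw [h]
    exact add_mem (mem_adjoin_simple_self ℚ ζ) (inv_mem (mem_adjoin_simple_self ℚ ζ))
  exact hle hx

/-- The inclusion of `ℚ(2 cos(2π/p))` into the cyclotomic field `ℚ(ζ_p)`. -/
noncomputable def kqToCyclotomic (hζ : ζ = Complex.exp (2 * Real.pi * Complex.I / p)) :
    Kq p →+* ℚ⟮ζ⟯ :=
  (Complex.ofRealHom.comp (algebraMap (Kq p) ℝ)).codRestrict ℚ⟮ζ⟯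
    fun x => ofReal_mem_of_mem_Kq hζ x.2

lemma coe_kqToCyclotomic (hζ : ζ = Complex.exp (2 * Real.pi * Complex.I / p)) (x : Kq p) :
    (kqToCyclotomic hζ x : ℂ) = ((x : ℝ) : ℂ) := rfl

lemma adjoin_gen_eq_top {F E : Type*} [Field F] [Field E] [Algebra F E] (x : E) :
    F⟮AdjoinSimple.gen F x⟯ = ⊤ :=
  lift_injective F⟮x⟯ <| by rw [lift_adjoin_simple, lift_top, AdjoinSimple.coe_gen]

lemma trace_map_of_quadratic {K L : Type*} [Field K] [Field L] [CharZero K] [CharZero L]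
    [FiniteDimensional ℚ L] (f : K →+* L) {w : K} {z : L} (hz : z ^ 2 - f w * z + 1 = 0)
    (htop : ℚ⟮z⟯ = ⊤) (hmem : ∀ x, f x ≠ z) (x : K) :
    Algebra.trace ℚ L (f x) = 2 * Algebra.trace ℚ K x := by
  algebraize [f]
  let P : K[X] := X ^ 2 - C w * X + 1
  have hdeg : P.natDegree = 2 := by
    simp only [P]
    compute_degree!
  have hmonic : P.Monic := by
    simp only [P]
    monicity!
  have hroot : aeval z P = 0 := by
    simpa [P, RingHom.algebraMap_toAlgebra] using hz
  have hint : IsIntegral K z := ⟨P, hmonic, hroot⟩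
  have hne : (minpoly K z).natDegree ≠ 1 := by
    rw [Ne, minpoly.natDegree_eq_one_iff]
    exact fun ⟨x, hx⟩ => hmem x hx
  have hle : (minpoly K z).natDegree ≤ 2 :=
    hdeg ▸ natDegree_le_of_dvd (minpoly.dvd _ _ hroot) hmonic.ne_zero
  have hpos := minpoly.natDegree_pos hint
  have hfin : Module.finrank K L = 2 := by
    rw [← finrank_top', ← adjoin_eq_top_of_adjoin_eq_top (E := K) ℚ htop, adjoin.finrank hint]
    omega
  have : Module.Finite ℚ K :=
    Module.Finite.of_injective f.toRatAlgHom.toLinearMap f.injective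
  have : Module.Finite K L := Module.finite_of_finrank_pos (by omega)
  rw [← Algebra.trace_trace (S := K)]
  change Algebra.trace ℚ K (Algebra.trace K L (algebraMap K L x)) = _
  rw [Algebra.trace_algebraMap, hfin, map_nsmul, nsmul_eq_mul, Nat.cast_ofNat]

lemma trace_kqToCyclotomic (hζ : ζ = Complex.exp (2 * Real.pi * Complex.I / p)) (hp : 2 < p)
    (x : Kq p) :
    Algebra.trace ℚ ℚ⟮ζ⟯ (kqToCyclotomic hζ x) = 2 * Algebra.trace ℚ (Kq p) x := by
  have hζ0 : ζ ≠ 0 := hζ ▸ Complex.exp_ne_zero _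
  have hζint : IsIntegral ℚ ζ :=
    hζ ▸ ((Complex.isPrimitiveRoot_exp p (by omega)).isIntegral (by omega)).tower_top
  have : FiniteDimensional ℚ ℚ⟮ζ⟯ := adjoin.finiteDimensional hζint
  let w : Kq p := ⟨2 * Real.cos (2 * Real.pi / p), subset_adjoin _ _ rfl⟩
  have hw : ((w : ℝ) : ℂ) = ζ + ζ⁻¹ := by
    have h := omegaJReal_eq hζ 1
    rwa [omegaJReal, Nat.cast_one, mul_one, pow_one] at h
  refine trace_map_of_quadratic (kqToCyclotomic hζ) (w := w) (z := AdjoinSimple.gen ℚ ζ)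
    ?_ ?_ ?_ x
  · apply Subtype.ext
    push_cast
    rw [coe_kqToCyclotomic, hw, AdjoinSimple.coe_gen]
    field_simp
    ring
  · exact adjoin_gen_eq_top ζ
  · intro x hx
    have hx' := congrArg (fun y : ℚ⟮ζ⟯ => (y : ℂ).im) hx
    simp only [coe_kqToCyclotomic, AdjoinSimple.coe_gen, Complex.ofReal_im] at hx'
    have h1 : 2 * (Real.pi : ℂ) * Complex.I / p = ((2 * Real.pi / p : ℝ) : ℂ) * Complex.I := by
      push_cast
      ring
    rw [hζ, h1, Complex.exp_ofReal_mul_I_im] at hx'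
    have hp' : (2 : ℝ) < p := by exact_mod_cast hp
    refine (Real.sin_pos_of_pos_of_lt_pi (by positivity) ?_).ne hx'
    rw [div_lt_iff₀ (by linarith)]
    nlinarith [Real.pi_pos]

lemma isCyclotomicExtension_adjoin_exp [NeZero p]
    (hζ : ζ = Complex.exp (2 * Real.pi * Complex.I / p)) : IsCyclotomicExtension {p} ℚ ℚ⟮ζ⟯ := by
  have hprim : IsPrimitiveRoot ζ p := hζ ▸ Complex.isPrimitiveRoot_exp p (NeZero.ne p)
  change IsCyclotomicExtension {p} ℚ ℚ⟮ζ⟯.toSubalgebra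
  rw [adjoin_simple_toSubalgebra_of_isAlgebraic
    (hprim.isIntegral (NeZero.pos p)).tower_top.isAlgebraic]
  exact hprim.adjoin_isCyclotomicExtension ℚ

/-- Every integer of `ℚ(2 cos(2π/p))` has integral coordinates `(c₀, c₁, …, c_d)` with respect to
`1, ω₁, …, ω_d`, normalized by means of `1 + ω₁ + ⋯ + ω_d = 0`. -/
lemma exists_normalized_coordinates {d : ℕ} (hp : p.Prime) (hd : p = 2 * d + 1)
    (β : 𝓞 (Kq p)) : ∃ c : ℕ → ℤ,
      ((β : Kq p) : ℝ) = c 0 + ∑ i ∈ Icc 1 d, c i * omegaJReal p i ∧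
      2 * Algebra.trace ℚ (Kq p) ((β : Kq p) ^ 2) =
        (2 * d + 1) * ((c 0 ^ 2 + 2 * ∑ i ∈ Icc 1 d, c i ^ 2 : ℤ) : ℚ) -
          ((c 0 + 2 * ∑ i ∈ Icc 1 d, c i : ℤ) : ℚ) ^ 2 ∧
      2 * |c 0 + 2 * ∑ i ∈ Icc 1 d, c i| ≤ 2 * d + 1 := by
  have : Fact p.Prime := ⟨hp⟩
  have hp2 : 2 < p := by
    have := hp.two_le
    omega
  obtain ⟨ζ, hζ⟩ : ∃ ζ, ζ = Complex.exp (2 * Real.pi * Complex.I / p) := ⟨_, rfl⟩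
  have := isCyclotomicExtension_adjoin_exp hζ
  have hz : IsPrimitiveRoot (AdjoinSimple.gen ℚ ζ) p := by
    rw [← IsPrimitiveRoot.coe_submonoidClass_iff, AdjoinSimple.coe_gen]
    exact hζ ▸ Complex.isPrimitiveRoot_exp p hp.ne_zero
  set ψ := AddChar.zmodChar p hz.pow_eq_one with hψ
  have hψc (j : ℕ) : ((ψ j : ℚ⟮ζ⟯) : ℂ) = ζ ^ j := by
    rw [hψ, AddChar.zmodChar_apply']
    rfl
  have hψn (j : ZMod p) : ((ψ (-j) : ℚ⟮ζ⟯) : ℂ) = ((ψ j : ℚ⟮ζ⟯) : ℂ)⁻¹ := by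
    rw [AddChar.map_neg_eq_inv]
    rfl
  have hconj (j : ZMod p) : (starRingEnd ℂ) (ψ j : ℚ⟮ζ⟯) = (ψ (-j) : ℚ⟮ζ⟯) := by
    have h1 : ‖((ψ j : ℚ⟮ζ⟯) : ℂ)‖ = 1 := by
      rw [← ZMod.natCast_zmod_val j, hψc]
      rw [norm_pow, (hζ ▸ Complex.isPrimitiveRoot_exp p hp.ne_zero :
        IsPrimitiveRoot ζ p).norm'_eq_one hp.ne_zero, one_pow]
    rw [hψn, Complex.inv_eq_conj h1]
  set x := kqToCyclotomic hζ β with hx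
  have hxint : IsIntegral ℤ x := (β.isIntegral_coe).map (kqToCyclotomic hζ).toIntAlgHom
  obtain ⟨a, ha⟩ := exists_eq_sum_zmodChar hz hxint
  rw [← hψ] at ha
  have hsymm (j : ZMod p) : a (-j) = a j := by
    have hreal : (starRingEnd ℂ) x = x := by
      rw [hx, coe_kqToCyclotomic, Complex.conj_ofReal]
    have hx2 : x = ∑ j, (a (-j) : ℚ⟮ζ⟯) * ψ j := by
      rw [← Equiv.sum_comp (Equiv.neg (ZMod p))]
      apply Subtype.ext
      rw [← hreal, ha]
      simp [hconj]
    have h0 : ∑ j, (((fun j => a (-j) - a j) j : ℤ) : ℚ⟮ζ⟯) * ψ j = 0 := by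
      simp only [Int.cast_sub, sub_mul, sum_sub_distrib]
      rw [← ha, ← hx2, sub_self]
    have := eq_of_sum_zmodChar_eq_zero hz h0 j 0
    simp only [neg_zero, sub_self] at this
    linarith
  obtain ⟨m, hm⟩ := exists_two_mul_abs_add_mul_le p hp.pos (∑ j, a j)
  set b : ZMod p → ℤ := fun j => a j + m with hb
  have hbsymm (j : ZMod p) : b (-j) = b j := by simp only [hb, hsymm]
  have hbx : x = ∑ j, (b j : ℚ⟮ζ⟯) * ψ j := by
    simp only [hb, Int.cast_add, add_mul, sum_add_distrib, ← mul_sum]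
    rw [sum_zmodChar_eq_zero hz, mul_zero, add_zero, ha]
  have hsum {f : ZMod p → ℤ} (hf : ∀ j, f (-j) = f j) :
      ∑ j, f j = f 0 + 2 * ∑ i ∈ Icc 1 d, f i := by
    rw [ZMod.sum_eq_zero_add_sum_Icc hd, mul_sum]
    simp only [hf, two_mul]
  refine ⟨fun i => b i, ?_, ?_, ?_⟩
  · apply Complex.ofReal_injective
    rw [← coe_kqToCyclotomic hζ, ← hx, hbx, ZMod.sum_eq_zero_add_sum_Icc hd]
    push_cast
    simp only [omegaJReal_eq hζ, hbsymm, hψn, hψc, AddChar.map_zero_eq_one, mul_add]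
    simp
  · rw [← trace_kqToCyclotomic hζ hp2, map_pow, ← hx, hbx, trace_sq_sum_zmodChar hz hbsymm,
      hsum hbsymm, hsum (f := fun j => b j ^ 2) fun j => by rw [hbsymm]]
    have hpd : (p : ℚ) = 2 * d + 1 := by exact_mod_cast hd
    simp only [hpd, Nat.cast_zero]
  · have hpd : (p : ℤ) = 2 * d + 1 := by exact_mod_cast hd
    simp only [Nat.cast_zero]
    rw [← hsum hbsymm, ← hpd]
    simpa [hb, sum_add_distrib] using hm

end RealSubfield

/-- Let `p ≥ 29` be a prime, `d = (p-1)/2`, and `β ∈ 𝓞_{K_p}` with `Tr(β²) < 4d + 2`. Then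
`±β` is one of `0`, `1`, `ω_i`, `ω_i + 1`, `ω_i - 1`, `ω_i + ω_h`, `2` (with
`i, h ∈ {1, …, d}`, `i ≠ h`), with traces `0`, `d`, `2d - 1`, `3d - 3`, `3d + 1`, `4d - 6`,
`4d`, respectively. -/
theorem stmt17 (p : ℕ) (hp : p.Prime) (hp29 : 29 ≤ p) (d : ℕ) (hd : d = (p - 1) / 2)
    (β : 𝓞 ↥(Kq p))
    (hTr : Algebra.trace ℚ ↥(Kq p) ((β : ↥(Kq p)) ^ 2) < 4 * (d : ℚ) + 2) :
    (((β : ↥(Kq p)) : ℝ) = 0 ∧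
      Algebra.trace ℚ ↥(Kq p) ((β : ↥(Kq p)) ^ 2) = 0) ∨
    ((((β : ↥(Kq p)) : ℝ) = 1 ∨ ((β : ↥(Kq p)) : ℝ) = -1) ∧
      Algebra.trace ℚ ↥(Kq p) ((β : ↥(Kq p)) ^ 2) = (d : ℚ)) ∨
    ((∃ i : ℕ, 1 ≤ i ∧ i ≤ d ∧
        (((β : ↥(Kq p)) : ℝ) = omegaJReal p i ∨ ((β : ↥(Kq p)) : ℝ) = -omegaJReal p i)) ∧
      Algebra.trace ℚ ↥(Kq p) ((β : ↥(Kq p)) ^ 2) = 2 * (d : ℚ) - 1) ∨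
    ((∃ i : ℕ, 1 ≤ i ∧ i ≤ d ∧
        (((β : ↥(Kq p)) : ℝ) = omegaJReal p i + 1 ∨
          ((β : ↥(Kq p)) : ℝ) = -(omegaJReal p i + 1))) ∧
      Algebra.trace ℚ ↥(Kq p) ((β : ↥(Kq p)) ^ 2) = 3 * (d : ℚ) - 3) ∨
    ((∃ i : ℕ, 1 ≤ i ∧ i ≤ d ∧
        (((β : ↥(Kq p)) : ℝ) = omegaJReal p i - 1 ∨
          ((β : ↥(Kq p)) : ℝ) = -(omegaJReal p i - 1))) ∧
      Algebra.trace ℚ ↥(Kq p) ((β : ↥(Kq p)) ^ 2) = 3 * (d : ℚ) + 1) ∨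
    ((∃ i h : ℕ, 1 ≤ i ∧ i ≤ d ∧ 1 ≤ h ∧ h ≤ d ∧ i ≠ h ∧
        (((β : ↥(Kq p)) : ℝ) = omegaJReal p i + omegaJReal p h ∨
          ((β : ↥(Kq p)) : ℝ) = -(omegaJReal p i + omegaJReal p h))) ∧
      Algebra.trace ℚ ↥(Kq p) ((β : ↥(Kq p)) ^ 2) = 4 * (d : ℚ) - 6) ∨
    ((((β : ↥(Kq p)) : ℝ) = 2 ∨ ((β : ↥(Kq p)) : ℝ) = -2) ∧
      Algebra.trace ℚ ↥(Kq p) ((β : ↥(Kq p)) ^ 2) = 4 * (d : ℚ)) := by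
  have hodd := hp.eq_two_or_odd
  obtain ⟨c, hc, ht, hS⟩ := exists_normalized_coordinates (d := d) hp (by omega) β
  exact eq_short_combination_of_lt d (by omega) c (omegaJReal p) _ _ hc ht hS hTr
end
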